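/- Let I ⊂ ℝ be a compact interval, f = (f₁,…,f_n) : I → ℝⁿ a C^(n) map with f₁(x) = x whose Wronskian det(f_i^(j)(x))_{1≤i,j≤n} is nonzero for every x ∈ I. Then there is a constant δ > 0 with the following property: for any x₀ ∈ I there is a neighbourhood I₀ ⊂ I of x₀ such that for any interval J ⊂ I₀ there exists Q₁ > 0 such that for all Q > Q₁ one has |Φ(Q,δ) ∩ J| < |J|/2, where Φ(Q,δ) is the set of x ∈ I for which |F(x)| < δQ^{−n} for some F ∈ F_n(Q). -/

import Mathlib

open MeasureTheory Filter Set

/-- `G j` is continuous on `[a, b]` and has derivative `G (j + 1)` on `(a, b)`, for all `j < k`. -/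
def DerivChain (G : ℕ → ℝ → ℝ) (k : ℕ) (a b : ℝ) : Prop :=
  ∀ j < k, ContinuousOn (G j) (Icc a b) ∧ ∀ x ∈ Ioo a b, HasDerivAt (G j) (G (j + 1) x) x

/-- Generalized Rolle theorem. -/
lemma DerivChain.exists_eq_zero {a b : ℝ} (k : ℕ) : ∀ {G : ℕ → ℝ → ℝ} {x : ℕ → ℝ},
    DerivChain G k a b → (∀ i < k, x i < x (i + 1)) → (∀ i ≤ k, x i ∈ Icc a b) →
    (∀ i ≤ k, G 0 (x i) = 0) → ∃ ξ ∈ Icc a b, G k ξ = 0 := by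
  induction k with
  | zero => intro G x _ _ hx h0; exact ⟨x 0, hx 0 le_rfl, h0 0 le_rfl⟩
  | succ k ih =>
    intro G x hG hlt hx h0
    have key : ∀ i, ∃ y, i < k + 1 → y ∈ Ioo (x i) (x (i + 1)) ∧ G 1 y = 0 := by
      intro i
      by_cases hi : i < k + 1
      · obtain ⟨hc, hd⟩ := hG 0 (by omega)
        have h1 := (hx i (by omega)).1
        have h2 := (hx (i + 1) (by omega)).2
        obtain ⟨y, hy, hy'⟩ := exists_hasDerivAt_eq_zero (hlt i hi)
          (hc.mono (Icc_subset_Icc h1 h2))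
          ((h0 i (by omega)).trans (h0 (i + 1) (by omega)).symm)
          (fun z hz => hd z ⟨h1.trans_lt hz.1, hz.2.trans_le h2⟩)
        exact ⟨y, fun _ => ⟨hy, hy'⟩⟩
      · exact ⟨0, fun h => absurd h hi⟩
    choose y hy using key
    refine ih (G := fun j => G (j + 1)) (x := y) (fun j hj => hG (j + 1) (by omega))
      (fun i hi => ((hy i (by omega)).1.2).trans (hy (i + 1) (by omega)).1.1)
      (fun i hi => ?_) (fun i hi => (hy i (by omega)).2)
    have := (hy i (by omega)).1
    exact ⟨(hx i (by omega)).1.trans this.1.le, this.2.le.trans (hx (i + 1) (by omega)).2⟩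

/-- The divided difference of `F` at the nodes `t`. -/
noncomputable def dividedDiff (t : Finset ℝ) (F : ℝ → ℝ) : ℝ :=
  ∑ i ∈ t, F i / ∏ j ∈ t.erase i, (i - j)

/-- Mean value theorem for divided differences. -/
lemma DerivChain.exists_eq_dividedDiff {a b : ℝ} {k : ℕ} {G : ℕ → ℝ → ℝ} {t : Finset ℝ}
    (hG : DerivChain G k a b) (ht : ↑t ⊆ Icc a b) (hk : t.card = k + 1) :
    ∃ ξ ∈ Icc a b, G k ξ = k.factorial * dividedDiff t (G 0) := by
  set p := Lagrange.interpolate t id (G 0) with hp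
  have hdeg : p.degree < t.card := Lagrange.degree_interpolate_lt _ Function.injective_id.injOn
  have hcoeff : p.coeff k = dividedDiff t (G 0) := by
    have := Lagrange.coeff_eq_sum (s := t) (v := id) Function.injective_id.injOn hdeg
    rw [hk] at this
    rw [show k = k + 1 - 1 by omega, this, dividedDiff]
    refine Finset.sum_congr rfl fun i hi => ?_
    rw [hp, Lagrange.eval_interpolate_at_node _ Function.injective_id.injOn hi]
    rfl
  let e := t.orderEmbOfFin hk
  have hchain : DerivChain (fun j x => G j x - (Polynomial.derivative^[j] p).eval x) k a b := by
    intro j hj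
    refine ⟨(hG j hj).1.sub (Polynomial.continuous _).continuousOn, fun x hx => ?_⟩
    refine ((hG j hj).2 x hx).sub ?_
    rw [Function.iterate_succ_apply']
    exact Polynomial.hasDerivAt _ _
  obtain ⟨ξ, hξ, h⟩ := hchain.exists_eq_zero k
    (x := fun i => if h : i < k + 1 then e ⟨i, h⟩ else 0)
    (fun i hi => by
      simp only [dif_pos (show i < k + 1 by omega), dif_pos (show i + 1 < k + 1 by omega)]
      exact e.strictMono (by simp))
    (fun i hi => by
      simp only [dif_pos (show i < k + 1 by omega)]
      exact ht (t.orderEmbOfFin_mem hk _))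
    (fun i hi => by
      simp only [dif_pos (show i < k + 1 by omega), Function.iterate_zero, id]
      have := Lagrange.eval_interpolate_at_node (v := id) (G 0) Function.injective_id.injOn
        (t.orderEmbOfFin_mem hk ⟨i, by omega⟩)
      rw [hp, sub_eq_zero]; exact this.symm)
  refine ⟨ξ, hξ, ?_⟩
  rw [sub_eq_zero.1 h, ← hcoeff]
  have h0 : (Polynomial.derivative^[k] p).natDegree ≤ 0 := by
    refine (Polynomial.natDegree_iterate_derivative p k).trans ?_
    have : p.natDegree ≤ k := Polynomial.natDegree_le_of_degree_le
      (by rw [hk] at hdeg; exact Order.le_of_lt_succ (by exact_mod_cast hdeg))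
    omega
  rw [Polynomial.eq_C_of_natDegree_le_zero h0, Polynomial.eval_C, Polynomial.coeff_iterate_derivative]
  simp [Nat.descFactorial_self]

lemma exists_finset_separated {h : ℝ} (hh : 0 < h) (k : ℕ) : ∀ {E : Set ℝ}, IsCompact E →
    ENNReal.ofReal (k * h) < volume E →
    ∃ t : Finset ℝ, ↑t ⊆ E ∧ t.card = k + 1 ∧ ∀ x ∈ t, ∀ y ∈ t, x ≠ y → h ≤ |x - y| := by
  induction k with
  | zero =>
    intro E _ hvol
    have : E.Nonempty := nonempty_of_measure_ne_zero (pos_of_gt hvol).ne'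
    obtain ⟨x, hx⟩ := this
    exact ⟨{x}, by simpa using hx, by simp, by simp +contextual⟩
  | succ k ih =>
    intro E hE hvol
    have hne : E.Nonempty := nonempty_of_measure_ne_zero (pos_of_gt hvol).ne'
    obtain ⟨m, hm, hmin⟩ := hE.exists_isLeast hne
    have hvol' : ENNReal.ofReal (k * h) < volume (E ∩ Ici (m + h)) := by
      by_contra! hcon
      have hsub : E ⊆ Ico m (m + h) ∪ E ∩ Ici (m + h) := by
        intro x hx
        rcases lt_or_ge x (m + h) with hxm | hxm
        · exact Or.inl ⟨hmin hx, hxm⟩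
        · exact Or.inr ⟨hx, hxm⟩
      have := (measure_mono hsub).trans (measure_union_le (μ := volume) _ _)
      rw [Real.volume_Ico] at this
      have h2 := this.trans (add_le_add_right hcon _)
      rw [← ENNReal.ofReal_add (by linarith) (by positivity)] at h2
      refine absurd (hvol.trans_le h2) (not_lt.2 (ENNReal.ofReal_le_ofReal ?_))
      push_cast; linarith
    obtain ⟨t, ht, hc, hs⟩ := ih (hE.inter_right isClosed_Ici) hvol'
    have hge : ∀ x ∈ t, m + h ≤ x := fun x hx => (ht hx).2
    have hmt : m ∉ t := fun hx => by linarith [hge m hx]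
    refine ⟨insert m t, ?_, by rw [Finset.card_insert_of_notMem hmt, hc], ?_⟩
    · rw [Finset.coe_insert]
      exact insert_subset hm (ht.trans inter_subset_left)
    · intro x hx y hy hxy
      rw [Finset.mem_insert] at hx hy
      rcases hx with rfl | hx <;> rcases hy with rfl | hy
      · exact absurd rfl hxy
      · rw [abs_sub_comm]; exact le_trans (by linarith [hge y hy]) (le_abs_self _)
      · exact le_trans (by linarith [hge x hx]) (le_abs_self _)
      · exact hs x hx y hy hxy

lemma abs_dividedDiff_le {t : Finset ℝ} {F : ℝ → ℝ} {h s : ℝ} {k : ℕ} (hh : 0 < h)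
    (hk : t.card = k + 1) (hsep : ∀ x ∈ t, ∀ y ∈ t, x ≠ y → h ≤ |x - y|)
    (hF : ∀ x ∈ t, |F x| ≤ s) : |dividedDiff t F| ≤ (k + 1) * (s / h ^ k) := by
  have : ∀ i ∈ t, |F i / ∏ j ∈ t.erase i, (i - j)| ≤ s / h ^ k := by
    intro i hi
    rw [abs_div, Finset.abs_prod]
    have : h ^ k ≤ ∏ j ∈ t.erase i, |i - j| := by
      have hc : (t.erase i).card = k := by rw [Finset.card_erase_of_mem hi, hk]; rfl
      rw [← hc, ← Finset.prod_const]
      refine Finset.prod_le_prod (fun _ _ => hh.le) fun j hj => ?_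
      exact hsep i hi j (Finset.mem_of_mem_erase hj) (Finset.ne_of_mem_erase hj).symm
    exact div_le_div₀ ((abs_nonneg _).trans (hF i hi)) (hF i hi) (by positivity) this
  refine (Finset.abs_sum_le_sum_abs _ _).trans ((Finset.sum_le_sum this).trans ?_)
  rw [Finset.sum_const, hk, nsmul_eq_mul]; push_cast; rfl

lemma abs_le_of_dividedDiff_insert {t : Finset ℝ} {F : ℝ → ℝ} {y h s L A : ℝ} {k : ℕ}
    (hh : 0 < h) (hL : 0 ≤ L) (hk : t.card = k + 1) (hy : y ∉ t)
    (hsep : ∀ x ∈ t, ∀ y ∈ t, x ≠ y → h ≤ |x - y|) (hF : ∀ x ∈ t, |F x| ≤ s)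
    (hyL : ∀ x ∈ t, |y - x| ≤ L) (hA : |dividedDiff (insert y t) F| ≤ A) :
    |F y| ≤ A * L ^ (k + 1) + (k + 1) * (s * (L / h) ^ k) := by
  have hne : ∀ x ∈ t, y - x ≠ 0 := fun x hx h => hy (by rwa [sub_eq_zero.1 h])
  have hP0 : ∏ j ∈ t, (y - j) ≠ 0 := Finset.prod_ne_zero_iff.2 hne
  have hterm : ∀ i ∈ t, (F i / ∏ j ∈ (insert y t).erase i, (i - j)) * ∏ j ∈ t, (y - j) =
      - (F i * ∏ j ∈ t.erase i, ((y - j) / (i - j))) := by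
    intro i hi
    have hiy : i ≠ y := fun h => hy (h ▸ hi)
    rw [Finset.erase_insert_of_ne hiy.symm, Finset.prod_insert (by simp [hy]),
      ← Finset.mul_prod_erase t (fun j => y - j) hi, Finset.prod_div_distrib]
    have h1 : i - y ≠ 0 := sub_ne_zero.2 hiy
    have h2 : ∏ j ∈ t.erase i, (i - j) ≠ 0 := Finset.prod_ne_zero_iff.2 fun j hj =>
      sub_ne_zero.2 (Finset.ne_of_mem_erase hj).symm
    field_simp
    ring
  have hid : F y = dividedDiff (insert y t) F * ∏ j ∈ t, (y - j) +
      ∑ i ∈ t, F i * ∏ j ∈ t.erase i, ((y - j) / (i - j)) := by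
    rw [dividedDiff, Finset.sum_insert hy, Finset.erase_insert hy, add_mul, Finset.sum_mul,
      Finset.sum_congr rfl hterm, Finset.sum_neg_distrib, div_mul_cancel₀ _ hP0]
    ring
  have h1 : |∏ j ∈ t, (y - j)| ≤ L ^ (k + 1) := by
    rw [Finset.abs_prod, ← hk, ← Finset.prod_const]
    exact Finset.prod_le_prod (fun _ _ => abs_nonneg _) hyL
  have h2 : |∑ i ∈ t, F i * ∏ j ∈ t.erase i, ((y - j) / (i - j))| ≤
      (k + 1) * (s * (L / h) ^ k) := by
    have : ∀ i ∈ t, |F i * ∏ j ∈ t.erase i, ((y - j) / (i - j))| ≤ s * (L / h) ^ k := by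
      intro i hi
      rw [abs_mul, Finset.abs_prod]
      have hc : (t.erase i).card = k := by rw [Finset.card_erase_of_mem hi, hk]; rfl
      refine mul_le_mul (hF i hi) ?_ (Finset.prod_nonneg fun _ _ => abs_nonneg _)
        ((abs_nonneg _).trans (hF i hi))
      rw [← hc, ← Finset.prod_const]
      refine Finset.prod_le_prod (fun _ _ => abs_nonneg _) fun j hj => ?_
      rw [abs_div]
      have hj' := Finset.mem_of_mem_erase hj
      exact div_le_div₀ hL (hyL j hj') hh (hsep i hi j hj' (Finset.ne_of_mem_erase hj).symm)
    refine (Finset.abs_sum_le_sum_abs _ _).trans ((Finset.sum_le_sum this).trans ?_)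
    rw [Finset.sum_const, hk, nsmul_eq_mul]; push_cast; rfl
  rw [hid]
  refine (abs_add_le _ _).trans (add_le_add ?_ h2)
  rw [abs_mul]
  exact mul_le_mul hA h1 (abs_nonneg _) ((abs_nonneg _).trans hA)

lemma DerivChain.abs_le_of_separated {a b D h s : ℝ} {k : ℕ} {G : ℕ → ℝ → ℝ} {t : Finset ℝ}
    (hG : DerivChain G k a b) (hD : ∀ x ∈ Icc a b, |G k x - D| ≤ |D| / 2)
    (ht : ↑t ⊆ Icc a b) (hh : 0 < h) (hk : t.card = k + 1)
    (hsep : ∀ x ∈ t, ∀ y ∈ t, x ≠ y → h ≤ |x - y|) (hF : ∀ x ∈ t, |G 0 x| ≤ s) :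
    |D| ≤ 2 * (k.factorial * ((k + 1) * (s / h ^ k))) := by
  obtain ⟨ξ, hξ, hξ'⟩ := hG.exists_eq_dividedDiff ht hk
  have h1 := hD ξ hξ
  have h2 : |G k ξ| ≤ k.factorial * ((k + 1) * (s / h ^ k)) := by
    rw [hξ', abs_mul, Nat.abs_cast]
    exact mul_le_mul_of_nonneg_left (abs_dividedDiff_le hh hk hsep hF) (by positivity)
  have h3 : |D| ≤ |G k ξ| + |G k ξ - D| := by
    have := abs_sub (G k ξ) (G k ξ - D)
    simpa using this
  linarith

/-- A Remez type inequality for functions whose `k`-th derivative is almost constant. -/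
lemma DerivChain.volume_sublevel_le {a b D θ η s : ℝ} {n k : ℕ} {G : ℕ → ℝ → ℝ}
    (hG : DerivChain G k a b) (hD : ∀ x ∈ Icc a b, |G k x - D| ≤ |D| / 2)
    (hk1 : 1 ≤ k) (hkn : k ≤ n) (hθ : 0 < θ) (hθ1 : θ ≤ 1)
    (hη : η * ((4 * n + 3) * ((n + 1) / θ) ^ n) < 1) {u v : ℝ} (huv : u < v)
    (hJ : Icc u v ⊆ Icc a b) {y : ℝ} (hy : y ∈ Icc u v) (hy0 : 0 < |G 0 y|)
    (hs : s ≤ η * |G 0 y|) :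
    volume {x ∈ Icc u v | |G 0 x| ≤ s} ≤ ENNReal.ofReal (θ * (v - u)) := by
  by_contra! hcon
  set h := θ * (v - u) / (n + 1) with hhdef
  have hn : (0 : ℝ) < n + 1 := by positivity
  have hh : 0 < h := div_pos (mul_pos hθ (sub_pos.2 huv)) hn
  have hcomp : IsCompact {x ∈ Icc u v | |G 0 x| ≤ s} := by
    refine isCompact_Icc.of_isClosed_subset ?_ (fun x hx => hx.1)
    exact ((hG 0 (by omega)).1.mono hJ).abs.preimage_isClosed_of_isClosed isClosed_Icc isClosed_Iic
  obtain ⟨t, ht, hc, hsep⟩ := exists_finset_separated hh k hcomp (lt_of_le_of_lt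
    (ENNReal.ofReal_le_ofReal (by
      rw [hhdef, mul_div_assoc', div_le_iff₀ hn, mul_comm]
      refine mul_le_mul_of_nonneg_left ?_ (mul_pos hθ (sub_pos.2 huv)).le
      have : (k : ℝ) ≤ n := by exact_mod_cast hkn
      linarith)) hcon)
  have htF : ∀ x ∈ t, |G 0 x| ≤ s := fun x hx => (ht hx).2
  have htJ : ∀ x ∈ t, x ∈ Icc u v := fun x hx => (ht hx).1
  have hDle := hG.abs_le_of_separated hD (fun x hx => hJ (htJ x hx)) hh hc hsep htF
  obtain ⟨z, hz⟩ : t.Nonempty := Finset.card_pos.1 (by omega)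
  have hs0 : 0 ≤ s := (abs_nonneg _).trans (htF z hz)
  set R := (n + 1) / θ with hR
  have hR1 : 1 ≤ R := by rw [hR, le_div_iff₀ hθ]; have : (0 : ℝ) ≤ n := by positivity
                         linarith
  have hLR : (v - u) / h = R := by
    have := sub_pos.2 huv
    rw [hhdef, hR]; field_simp
  have hn0 : (0 : ℝ) ≤ n := by positivity
  have hbig : 1 ≤ (4 * n + 3) * R ^ n := by nlinarith [one_le_pow₀ hR1 (n := n)]
  have hη0 : 0 ≤ η := by
    by_contra! hneg
    nlinarith
  have hη1 : η < 1 := by nlinarith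
  have hyt : y ∉ t := fun h' => by
    have := htF y h'
    nlinarith
  obtain ⟨m, rfl⟩ : ∃ m, k = m + 1 := ⟨k - 1, by omega⟩
  have hc' : (t.erase z).card = m + 1 := by rw [Finset.card_erase_of_mem hz, hc]; rfl
  have hyt' : y ∉ t.erase z := fun h' => hyt (Finset.mem_of_mem_erase h')
  have hmem : ∀ x ∈ t.erase z, x ∈ t := fun x hx => Finset.mem_of_mem_erase hx
  obtain ⟨ξ, hξ, hξ'⟩ := hG.exists_eq_dividedDiff (t := insert y (t.erase z))
    (by
      intro x hx
      rw [Finset.coe_insert] at hx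
      rcases hx with rfl | hx
      · exact hJ hy
      · exact hJ (htJ x (hmem x hx)))
    (by rw [Finset.card_insert_of_notMem hyt', hc'])
  have hfac : (0 : ℝ) < (m + 1).factorial := by positivity
  have hA : |dividedDiff (insert y (t.erase z)) (G 0)| ≤
      3 * ((m + 1 + 1) * (s / h ^ (m + 1))) := by
    have h1 := hD ξ hξ
    have h3 : |G (m + 1) ξ| ≤ 3 / 2 * |D| := by
      have := abs_add_le (G (m + 1) ξ - D) D
      rw [sub_add_cancel] at this
      linarith
    rw [hξ', abs_mul, Nat.abs_cast] at h3
    refine le_of_mul_le_mul_left (h3.trans ?_) hfac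
    push_cast at hDle
    linarith
  have hfin := abs_le_of_dividedDiff_insert hh (sub_pos.2 huv).le hc' hyt'
    (fun x hx y hy => hsep x (hmem x hx) y (hmem y hy)) (fun x hx => htF x (hmem x hx))
    (fun x hx => by
      have := htJ x (hmem x hx)
      rw [abs_le]; constructor <;> linarith [hy.1, hy.2, this.1, this.2]) hA
  rw [hLR] at hfin
  have hmn : (m : ℝ) + 1 ≤ n := by exact_mod_cast hkn
  have e1 : 3 * ((m + 1 + 1) * (s / h ^ (m + 1))) * (v - u) ^ (m + 1) =
      3 * (m + 2) * s * R ^ (m + 1) := by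
    have h0 := hh.ne'
    clear_value h
    rw [← hLR, div_pow]
    field_simp
    ring
  rw [e1] at hfin
  have p1 : R ^ (m + 1) ≤ R ^ n := pow_le_pow_right₀ hR1 hkn
  have p2 : R ^ m ≤ R ^ n := pow_le_pow_right₀ hR1 (by omega)
  have hm0 : (0 : ℝ) ≤ m := by positivity
  have q1 : 3 * (m + 2) * s * R ^ (m + 1) ≤ 3 * (n + 1) * s * R ^ n := by
    have : (m : ℝ) + 2 ≤ n + 1 := by linarith
    gcongr
  have q2 : (m + 1) * (s * R ^ m) ≤ n * (s * R ^ n) := by gcongr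
  have q3 : |G 0 y| ≤ s * ((4 * n + 3) * R ^ n) := by nlinarith
  have q4 : s * ((4 * n + 3) * R ^ n) ≤ η * |G 0 y| * ((4 * n + 3) * R ^ n) :=
    mul_le_mul_of_nonneg_right hs (by linarith)
  nlinarith

lemma exists_subcover_card_le_two {ι : Type*} (l r : ι → ℝ) (t : Finset ι) :
    ∃ t' ⊆ t, (⋃ i ∈ t, Ioo (l i) (r i)) ⊆ (⋃ i ∈ t', Ioo (l i) (r i)) ∧
      ∀ x, Set.encard {i ∈ (t' : Set ι) | x ∈ Ioo (l i) (r i)} ≤ 2 := by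
  classical
  induction t using Finset.strongInduction with
  | H t ih =>
    by_cases h : ∃ i ∈ t, Ioo (l i) (r i) ⊆ ⋃ j ∈ t.erase i, Ioo (l j) (r j)
    · obtain ⟨i, hi, hsub⟩ := h
      obtain ⟨t', ht', hcov, hmul⟩ := ih _ (Finset.erase_ssubset hi)
      refine ⟨t', ht'.trans (Finset.erase_subset _ _), Subset.trans ?_ hcov, hmul⟩
      refine iUnion₂_subset fun j hj => ?_
      by_cases hji : j = i
      · exact hji ▸ hsub
      · exact subset_biUnion_of_mem (u := fun j => Ioo (l j) (r j))
          (show j ∈ (t.erase i : Finset ι) from Finset.mem_erase.2 ⟨hji, hj⟩)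
    · push Not at h
      refine ⟨t, subset_rfl, subset_rfl, fun x => ?_⟩
      rcases (t.filter fun i => x ∈ Ioo (l i) (r i)).eq_empty_or_nonempty with he | hne
      · have : {i ∈ (t : Set ι) | x ∈ Ioo (l i) (r i)} = ∅ := by
          rw [Finset.filter_eq_empty_iff] at he
          exact eq_empty_of_forall_notMem fun i hi => he hi.1 hi.2
        rw [this]; simp
      · obtain ⟨p, hp, hpmin⟩ := Finset.exists_min_image _ l hne
        obtain ⟨q, hq, hqmax⟩ := Finset.exists_max_image _ r hne
        refine (encard_le_encard (t := {p, q}) ?_).trans (?_)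
        swap
        · exact (encard_insert_le _ _).trans (by rw [encard_singleton]; norm_num)
        rintro i ⟨hi, hx⟩
        by_contra hcon
        simp only [mem_insert_iff, mem_singleton_iff, not_or] at hcon
        refine h i hi fun y hy => ?_
        have hi' : i ∈ t.filter fun i => x ∈ Ioo (l i) (r i) := Finset.mem_filter.2 ⟨hi, hx⟩
        have h1 := hpmin i hi'
        have h2 := hqmax i hi'
        rw [Finset.mem_filter] at hp hq
        rcases lt_or_ge y (r p) with hyp | hyp
        · exact mem_biUnion (show p ∈ (t.erase i : Finset ι) from
            Finset.mem_erase.2 ⟨Ne.symm hcon.1, hp.1⟩) ⟨h1.trans_lt hy.1, hyp⟩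
        · exact mem_biUnion (show q ∈ (t.erase i : Finset ι) from
            Finset.mem_erase.2 ⟨Ne.symm hcon.2, hq.1⟩)
            ⟨hq.2.1.trans (hp.2.2.trans_le hyp), hy.2.trans_le h2⟩

lemma volume_le_of_subset_biUnion_Ioo {ι : Type*} {l r : ι → ℝ} {N : Set ℝ} {M : ENNReal}
    {u v : ℝ} (t : Finset ι) (hN : N ⊆ ⋃ i ∈ t, Ioo (l i) (r i))
    (hsub : ∀ i ∈ t, Ioo (l i) (r i) ⊆ Icc u v)
    (hM : ∀ i ∈ t, volume (N ∩ Ioo (l i) (r i)) ≤ M * volume (Ioo (l i) (r i))) :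
    volume N ≤ 2 * M * volume (Icc u v) := by
  classical
  obtain ⟨t', ht', hcov, hmul⟩ := exists_subcover_card_le_two l r t
  have h1 : volume N ≤ ∑ i ∈ t', volume (N ∩ Ioo (l i) (r i)) := by
    refine le_trans (measure_mono ?_) (measure_biUnion_finset_le t' _)
    intro x hx
    obtain ⟨i, hi, hxi⟩ := mem_iUnion₂.1 (hcov (hN hx))
    exact mem_iUnion₂.2 ⟨i, hi, hx, hxi⟩
  have h2 : ∑ i ∈ t', volume (Ioo (l i) (r i)) ≤ 2 * volume (Icc u v) := by
    calc ∑ i ∈ t', volume (Ioo (l i) (r i))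
        = ∫⁻ x, ∑ i ∈ t', (Ioo (l i) (r i)).indicator 1 x := by
          rw [lintegral_finsetSum _ fun i _ => measurable_one.indicator measurableSet_Ioo]
          refine Finset.sum_congr rfl fun i _ => ?_
          rw [lintegral_indicator_one measurableSet_Ioo]
      _ ≤ ∫⁻ x, (Icc u v).indicator (fun _ => 2) x := by
          refine lintegral_mono fun x => ?_
          by_cases hx : x ∈ Icc u v
          · rw [indicator_of_mem hx]
            have h3 := hmul x
            have h4 : {i ∈ (t' : Set ι) | x ∈ Ioo (l i) (r i)} =
                ((t'.filter fun i => x ∈ Ioo (l i) (r i) : Finset ι) : Set ι) := by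
              ext; simp
            rw [h4, encard_coe_eq_coe_finsetCard] at h3
            simp only [indicator_apply, Pi.one_apply, Finset.sum_boole]
            exact_mod_cast h3
          · rw [indicator_of_notMem hx]
            refine (Finset.sum_eq_zero fun i hi => ?_).le
            exact indicator_of_notMem (fun h => hx (hsub i (ht' hi) h)) _
      _ = 2 * volume (Icc u v) := by
          rw [lintegral_indicator measurableSet_Icc, setLIntegral_const]
  calc volume N ≤ ∑ i ∈ t', M * volume (Ioo (l i) (r i)) :=
        h1.trans (Finset.sum_le_sum fun i hi => hM i (ht' hi))
    _ = M * ∑ i ∈ t', volume (Ioo (l i) (r i)) := (Finset.mul_sum _ _ _).symm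
    _ ≤ M * (2 * volume (Icc u v)) := by gcongr
    _ = 2 * M * volume (Icc u v) := by ring

/-- A covering bound: if `N` is covered by open subintervals of `[u, v]` and has density at most
`M` in each of them, then it has density at most `2 * M` in `[u, v]`. -/
lemma volume_le_of_subset_iUnion_Ioo {ι : Type*} {l r : ι → ℝ} {N : Set ℝ} {M : ENNReal}
    {u v : ℝ} (hN : N ⊆ ⋃ i, Ioo (l i) (r i)) (hsub : ∀ i, Ioo (l i) (r i) ⊆ Icc u v)
    (hM : ∀ i, volume (N ∩ Ioo (l i) (r i)) ≤ M * volume (Ioo (l i) (r i))) :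
    volume N ≤ 2 * M * volume (Icc u v) := by
  classical
  obtain ⟨T, hT, hTu⟩ := TopologicalSpace.isOpen_iUnion_countable
    (fun i => Ioo (l i) (r i)) fun i => isOpen_Ioo
  have : Countable T := hT.to_subtype
  have hNeq : N = ⋃ t : Finset T, N ∩ ⋃ i ∈ t, Ioo (l i) (r i) := by
    refine Subset.antisymm (fun x hx => ?_) (iUnion_subset fun t => inter_subset_left)
    have hx' := hN hx
    rw [← hTu] at hx'
    obtain ⟨i, hi, hxi⟩ := mem_iUnion₂.1 hx'
    exact mem_iUnion.2 ⟨{⟨i, hi⟩}, hx, by simpa using hxi⟩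
  have hmono : Monotone fun t : Finset T => N ∩ ⋃ i ∈ t, Ioo (l i) (r i) := by
    intro t t' htt
    exact inter_subset_inter_right _ (biUnion_subset_biUnion_left htt)
  rw [hNeq, hmono.directed_le.measure_iUnion]
  refine iSup_le fun t => ?_
  refine volume_le_of_subset_biUnion_Ioo (l := fun i : T => l i) (r := fun i : T => r i) t
    inter_subset_right (fun i _ => hsub i) fun i _ => ?_
  exact (measure_mono (inter_subset_inter_left _ inter_subset_left)).trans (hM i)

lemma exists_maximal_interval_lt {φ : ℝ → ℝ} {u v x ρ : ℝ} (hφ : ContinuousOn φ (Icc u v))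
    (hx : x ∈ Icc u v) (hlt : φ x < ρ) :
    ∃ l r, u ≤ l ∧ l ≤ x ∧ x ≤ r ∧ r ≤ v ∧ (l < x ∨ x = u) ∧ (x < r ∨ x = v) ∧
      (l = u ∨ ρ ≤ φ l) ∧ (r = v ∨ ρ ≤ φ r) ∧ ∀ y ∈ Ioo l r, φ y < ρ := by
  have hclosed : IsClosed {y ∈ Icc u v | ρ ≤ φ y} :=
    hφ.preimage_isClosed_of_isClosed isClosed_Icc isClosed_Ici
  have hL : ∃ l, u ≤ l ∧ l ≤ x ∧ (l < x ∨ x = u) ∧ (l = u ∨ ρ ≤ φ l) ∧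
      ∀ y, l < y → y ≤ x → φ y < ρ := by
    by_cases he : ({y ∈ Icc u v | ρ ≤ φ y} ∩ Iic x).Nonempty
    · have hc : IsCompact ({y ∈ Icc u v | ρ ≤ φ y} ∩ Iic x) :=
        isCompact_Icc.of_isClosed_subset (hclosed.inter isClosed_Iic) fun y hy => hy.1.1
      obtain ⟨l, hl, hmax⟩ := hc.exists_isGreatest he
      refine ⟨l, hl.1.1.1, hl.2, Or.inl (lt_of_le_of_ne hl.2 ?_), Or.inr hl.1.2, ?_⟩
      · rintro rfl
        exact absurd hl.1.2 (not_le.2 hlt)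
      · intro y hy hyx
        by_contra! hcon
        exact absurd (hmax ⟨⟨⟨hl.1.1.1.trans hy.le, hyx.trans hx.2⟩, hcon⟩, hyx⟩) (not_le.2 hy)
    · refine ⟨u, le_rfl, hx.1, hx.1.lt_or_eq.imp id Eq.symm, Or.inl rfl, fun y hy hyx => ?_⟩
      by_contra! hcon
      exact he ⟨y, ⟨⟨hy.le, hyx.trans hx.2⟩, hcon⟩, hyx⟩
  have hR : ∃ r, x ≤ r ∧ r ≤ v ∧ (x < r ∨ x = v) ∧ (r = v ∨ ρ ≤ φ r) ∧
      ∀ y, x ≤ y → y < r → φ y < ρ := by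
    by_cases he : ({y ∈ Icc u v | ρ ≤ φ y} ∩ Ici x).Nonempty
    · have hc : IsCompact ({y ∈ Icc u v | ρ ≤ φ y} ∩ Ici x) :=
        isCompact_Icc.of_isClosed_subset (hclosed.inter isClosed_Ici) fun y hy => hy.1.1
      obtain ⟨r, hr, hmin⟩ := hc.exists_isLeast he
      refine ⟨r, hr.2, hr.1.1.2, Or.inl (lt_of_le_of_ne hr.2 ?_), Or.inr hr.1.2, ?_⟩
      · rintro rfl
        exact absurd hr.1.2 (not_le.2 hlt)
      · intro y hxy hy
        by_contra! hcon
        exact absurd (hmin ⟨⟨⟨hx.1.trans hxy, hy.le.trans hr.1.1.2⟩, hcon⟩, hxy⟩) (not_le.2 hy)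
    · refine ⟨v, hx.2, le_rfl, hx.2.lt_or_eq, Or.inl rfl, fun y hxy hy => ?_⟩
      by_contra! hcon
      exact he ⟨y, ⟨⟨hx.1.trans hxy, hy.le⟩, hcon⟩, hxy⟩
  obtain ⟨l, h1, h2, h3, h4, h5⟩ := hL
  obtain ⟨r, k1, k2, k3, k4, k5⟩ := hR
  refine ⟨l, r, h1, h2, k1, k2, h3, k3, h4, k4, fun y hy => ?_⟩
  rcases le_total y x with hyx | hyx
  · exact h5 y hy.1 hyx
  · exact k5 y hyx hy.2

/-- `x` is marked by a chain in `S`: along the chain `ψ` lies in `(ε, ρ)`, and `ψ` is at least `ρ` at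
all other elements of `S` comparable with the whole chain. -/
def IsMarked {P : Type*} [PartialOrder P] (ψ : P → ℝ → ℝ) (ε ρ : ℝ) (S : Finset P) (x : ℝ) : Prop :=
  ∃ F ⊆ S, IsChain (· ≤ ·) (F : Set P) ∧ (∀ Γ ∈ F, ε < ψ Γ x ∧ ψ Γ x < ρ) ∧
    ∀ Γ ∈ S, Γ ∉ F → (∀ Δ ∈ F, Γ ≤ Δ ∨ Δ ≤ Γ) → ρ ≤ ψ Γ x

/-- The constant in the quantitative nondivergence estimate. -/
noncomputable def nondivConst (θ : ENNReal) : ℕ → ENNReal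
  | 0 => 0
  | k + 1 => 2 * (θ + nondivConst θ k)

/-- Quantitative nondivergence on an interval, in the form of Kleinbock and Margulis. -/
lemma volume_not_isMarked_le {P : Type*} [PartialOrder P] {rk : P → ℕ} (hrk : StrictMono rk)
    {ψ : P → ℝ → ℝ} {ε ρ : ℝ} {θ : ENNReal} (k : ℕ) : ∀ {S : Finset P} {u v : ℝ},
    (S.image rk).card ≤ k → (∀ Γ ∈ S, ContinuousOn (ψ Γ) (Icc u v)) →
    (∀ Γ ∈ S, ∀ u' v', u' < v' → Icc u' v' ⊆ Icc u v → (∃ y ∈ Icc u' v', ρ ≤ ψ Γ y) →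
      volume {x ∈ Icc u' v' | ψ Γ x ≤ ε} ≤ θ * volume (Icc u' v')) →
    (∀ Γ ∈ S, ∃ y ∈ Icc u v, ρ ≤ ψ Γ y) →
    volume {x ∈ Icc u v | ¬ IsMarked ψ ε ρ S x} ≤ nondivConst θ k * volume (Icc u v) := by
  classical
  have marked_of_le : ∀ {S : Finset P} {x : ℝ}, (∀ Γ ∈ S, ρ ≤ ψ Γ x) → IsMarked ψ ε ρ S x :=
    fun h => ⟨∅, by simp, by simp, by simp, fun Γ hΓ _ _ => h Γ hΓ⟩
  induction k with
  | zero =>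
    intro S u v hS _ _ _
    have hS0 : S = ∅ := by simpa using hS
    subst hS0
    have : {x ∈ Icc u v | ¬ IsMarked ψ ε ρ ∅ x} = ∅ :=
      eq_empty_of_forall_notMem fun x hx => hx.2 (marked_of_le (by simp))
    rw [this]; simp
  | succ k ih =>
    intro S u v hS hcont hgood hsup
    set N := {x ∈ Icc u v | ¬ IsMarked ψ ε ρ S x} with hNdef
    have hmax : ∀ x, ∀ Γ, ∃ l r, Γ ∈ S → x ∈ Icc u v → ψ Γ x < ρ →
        u ≤ l ∧ l ≤ x ∧ x ≤ r ∧ r ≤ v ∧ (l < x ∨ x = u) ∧ (x < r ∨ x = v) ∧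
        (l = u ∨ ρ ≤ ψ Γ l) ∧ (r = v ∨ ρ ≤ ψ Γ r) ∧ ∀ y ∈ Ioo l r, ψ Γ y < ρ := by
      intro x Γ
      by_cases h : Γ ∈ S ∧ x ∈ Icc u v ∧ ψ Γ x < ρ
      · obtain ⟨l, r, hlr⟩ := exists_maximal_interval_lt (hcont Γ h.1) h.2.1 h.2.2
        exact ⟨l, r, fun _ _ _ => hlr⟩
      · exact ⟨0, 0, fun h1 h2 h3 => absurd ⟨h1, h2, h3⟩ h⟩
    choose l r hlr using hmax
    have hex : ∀ x ∈ N, ∃ Γ ∈ S, ψ Γ x < ρ ∧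
        ∀ Γ' ∈ S, ∃ y ∈ Icc (l x Γ) (r x Γ), ρ ≤ ψ Γ' y := by
      intro x hx
      have hne : (S.filter fun Γ => ψ Γ x < ρ).Nonempty := by
        by_contra hcon
        rw [Finset.not_nonempty_iff_eq_empty, Finset.filter_eq_empty_iff] at hcon
        exact hx.2 (marked_of_le fun Γ hΓ => not_lt.1 (hcon hΓ))
      obtain ⟨Γ, hΓ, hmax⟩ := Finset.exists_max_image _ (fun Γ => r x Γ - l x Γ) hne
      rw [Finset.mem_filter] at hΓ
      refine ⟨Γ, hΓ.1, hΓ.2, fun Γ' hΓ' => ?_⟩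
      by_contra! hcon
      obtain ⟨a1, a2, a3, a4, -⟩ := hlr x Γ hΓ.1 hx.1 hΓ.2
      have hlt' := hcon x ⟨a2, a3⟩
      obtain ⟨b1, b2, b3, b4, -, -, b7, b8, -⟩ := hlr x Γ' hΓ' hx.1 hlt'
      have hlen := hmax Γ' (Finset.mem_filter.2 ⟨hΓ', hlt'⟩)
      have hl : l x Γ' < l x Γ ∨ l x Γ = u ∧ l x Γ' = u := by
        rcases b7 with b7 | b7
        · rcases a1.lt_or_eq with h | h
          · exact Or.inl (b7 ▸ h)
          · exact Or.inr ⟨h.symm, b7⟩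
        · left
          by_contra! hle
          exact absurd b7 (not_le.2 (hcon _ ⟨hle, b2.trans a3⟩))
      have hr : r x Γ < r x Γ' ∨ r x Γ = v ∧ r x Γ' = v := by
        rcases b8 with b8 | b8
        · rcases a4.lt_or_eq with h | h
          · exact Or.inl (b8 ▸ h)
          · exact Or.inr ⟨h, b8⟩
        · left
          by_contra! hle
          exact absurd b8 (not_le.2 (hcon _ ⟨a2.trans b3, hle⟩))
      rcases hl with hl | hl
      · rcases hr with hr | hr <;> linarith [hr]
      · rcases hr with hr | hr
        · linarith [hl.1, hl.2]
        · obtain ⟨y, hy, hy'⟩ := hsup Γ' hΓ'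
          exact absurd hy' (not_le.2 (hcon y (by rw [hl.1, hr.1]; exact hy)))
    choose Γ hΓS hΓlt hΓsup using fun x : N => hex x x.2
    let L : N → ℝ := fun x => l x (Γ x)
    let R : N → ℝ := fun x => r x (Γ x)
    have hspec : ∀ x : N, _ := fun x => hlr x (Γ x) (hΓS x) x.2.1 (hΓlt x)
    have hsub : ∀ x : N, Icc (L x) (R x) ⊆ Icc u v := fun x =>
      Icc_subset_Icc (hspec x).1 (hspec x).2.2.2.1
    have hends : N \ {u, v} ⊆ ⋃ x : N, Ioo (L x) (R x) := by
      rintro x ⟨hx, hxe⟩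
      simp only [mem_insert_iff, mem_singleton_iff, not_or] at hxe
      obtain ⟨-, -, -, -, h5, h6, -⟩ := hspec ⟨x, hx⟩
      exact mem_iUnion.2 ⟨⟨x, hx⟩, h5.resolve_right hxe.1, h6.resolve_right hxe.2⟩
    have hnull : volume N = volume (N \ {u, v}) := by
      rw [measure_sdiff_null]
      exact (Set.toFinite {u, v}).measure_zero _
    rw [hnull]
    refine volume_le_of_subset_iUnion_Ioo hends (fun x => Ioo_subset_Icc_self.trans (hsub x))
      fun x => ?_
    rcases le_or_gt (R x) (L x) with hRL | hRL
    · simp [Ioo_eq_empty (not_lt.2 hRL)]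
    set S' := S.filter fun Δ => Δ ≠ Γ x ∧ (Δ ≤ Γ x ∨ Γ x ≤ Δ) with hS'
    have hS'S : S' ⊆ S := Finset.filter_subset _ _
    have hcard : (S'.image rk).card ≤ k := by
      have h1 : S'.image rk ⊆ (S.image rk).erase (rk (Γ x)) := by
        intro m hm
        obtain ⟨Δ, hΔ, rfl⟩ := Finset.mem_image.1 hm
        rw [hS', Finset.mem_filter] at hΔ
        refine Finset.mem_erase.2 ⟨?_, Finset.mem_image_of_mem _ hΔ.1⟩
        rcases hΔ.2.2 with h | h
        · exact (hrk (lt_of_le_of_ne h hΔ.2.1)).ne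
        · exact (hrk (lt_of_le_of_ne h hΔ.2.1.symm)).ne'
      have h2 := Finset.card_le_card h1
      rw [Finset.card_erase_of_mem (Finset.mem_image_of_mem _ (hΓS x))] at h2
      omega
    have hrec := ih (u := L x) (v := R x) hcard (fun Δ hΔ => (hcont Δ (hS'S hΔ)).mono (hsub x))
      (fun Δ hΔ u' v' h1 h2 => hgood Δ (hS'S hΔ) u' v' h1 (h2.trans (hsub x)))
      (fun Δ hΔ => hΓsup x Δ (hS'S hΔ))
    have hg := hgood (Γ x) (hΓS x) (L x) (R x) hRL (hsub x) (hΓsup x _ (hΓS x))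
    have hcov : N \ {u, v} ∩ Ioo (L x) (R x) ⊆ {y ∈ Icc (L x) (R x) | ψ (Γ x) y ≤ ε} ∪
        {y ∈ Icc (L x) (R x) | ¬ IsMarked ψ ε ρ S' y} := by
      rintro y ⟨⟨hyN, -⟩, hy⟩
      by_cases hyε : ψ (Γ x) y ≤ ε
      · exact Or.inl ⟨Ioo_subset_Icc_self hy, hyε⟩
      · refine Or.inr ⟨Ioo_subset_Icc_self hy, fun hmark => hyN.2 ?_⟩
        obtain ⟨F, hF, hch, hF1, hF2⟩ := hmark
        refine ⟨insert (Γ x) F, Finset.insert_subset (hΓS x) (hF.trans hS'S), ?_, ?_, ?_⟩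
        · rw [Finset.coe_insert]
          refine hch.insert fun Δ hΔ _ => ?_
          exact ((Finset.mem_filter.1 (hF hΔ)).2.2).symm
        · intro Δ hΔ
          rcases Finset.mem_insert.1 hΔ with rfl | hΔ
          · exact ⟨not_le.1 hyε, (hspec x).2.2.2.2.2.2.2.2 y hy⟩
          · exact hF1 Δ hΔ
        · intro Δ hΔS hΔF hcomp
          rw [Finset.mem_insert, not_or] at hΔF
          exact hF2 Δ (Finset.mem_filter.2 ⟨hΔS, hΔF.1, hcomp _ (Finset.mem_insert_self _ _)⟩)
            hΔF.2 fun Δ' hΔ' => hcomp _ (Finset.mem_insert_of_mem hΔ')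
    calc volume (N \ {u, v} ∩ Ioo (L x) (R x))
        ≤ θ * volume (Icc (L x) (R x)) + nondivConst θ k * volume (Icc (L x) (R x)) :=
          (measure_mono hcov).trans ((measure_union_le _ _).trans (add_le_add hg hrec))
      _ = (θ + nondivConst θ k) * volume (Ioo (L x) (R x)) := by
          rw [Real.volume_Icc, Real.volume_Ioo, add_mul]

/-- The sum of the absolute values of all minors of maximal size, over all choices of columns. -/
noncomputable def minorSum {r m : ℕ} (X : Matrix (Fin r) (Fin m) ℝ) : ℝ :=
  ∑ σ : Fin r → Fin m, |(X.submatrix id σ).det|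

lemma minorSum_nonneg {r m : ℕ} (X : Matrix (Fin r) (Fin m) ℝ) : 0 ≤ minorSum X :=
  Finset.sum_nonneg fun _ _ => abs_nonneg _

lemma abs_minor_le_minorSum {r m : ℕ} (X : Matrix (Fin r) (Fin m) ℝ) (σ : Fin r → Fin m) :
    |(X.submatrix id σ).det| ≤ minorSum X :=
  Finset.single_le_sum (f := fun σ : Fin r → Fin m => |(X.submatrix id σ).det|)
    (fun _ _ => abs_nonneg _) (Finset.mem_univ σ)

lemma minorSum_mul {r m : ℕ} (A : Matrix (Fin r) (Fin r) ℝ) (X : Matrix (Fin r) (Fin m) ℝ) :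
    minorSum (A * X) = |A.det| * minorSum X := by
  rw [minorSum, minorSum, Finset.mul_sum]
  refine Finset.sum_congr rfl fun σ _ => ?_
  rw [← abs_mul, ← Matrix.det_mul]
  congr 2

lemma minorSum_cons_le {r m : ℕ} (X : Matrix (Fin r) (Fin m) ℝ) (w : Fin m → ℝ) {ε : ℝ}
    (hw : ∀ j, |w j| ≤ ε) :
    minorSum (Matrix.of (Fin.cons w X)) ≤ (m : ℝ) ^ (r + 1) * ((r + 1) * (ε * minorSum X)) := by
  have key : ∀ σ : Fin (r + 1) → Fin m,
      |((Matrix.of (Fin.cons w X)).submatrix id σ).det| ≤ (r + 1) * (ε * minorSum X) := by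
    intro σ
    rw [Matrix.det_succ_row_zero]
    refine (Finset.abs_sum_le_sum_abs _ _).trans ?_
    refine (Finset.sum_le_card_nsmul _ _ (ε * minorSum X) fun j _ => ?_).trans ?_
    · rw [abs_mul, abs_mul, abs_pow, abs_neg, abs_one, one_pow, one_mul]
      exact mul_le_mul (hw (σ j)) (abs_minor_le_minorSum X (σ ∘ j.succAbove)) (abs_nonneg _)
        ((abs_nonneg _).trans (hw (σ j)))
    · simp [nsmul_eq_mul]
  refine (Finset.sum_le_card_nsmul _ _ _ fun σ _ => key σ).trans ?_
  simp [nsmul_eq_mul]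

lemma exists_minor_ne_zero {r m : ℕ} {X : Matrix (Fin r) (Fin m) ℝ}
    (hX : LinearIndependent ℝ X.row) : ∃ σ : Fin r → Fin m, (X.submatrix id σ).det ≠ 0 := by
  by_contra! hcon
  have hrank : X.rank = r := by simpa using hX.rank_matrix
  have hsurj : Function.Surjective X.mulVec := by
    have h1 : LinearMap.range X.mulVecLin = ⊤ :=
      Submodule.eq_top_of_finrank_eq (by rw [← Matrix.rank, hrank]; simp)
    exact LinearMap.range_eq_top.1 h1
  obtain ⟨B, hB⟩ := Matrix.mulVec_surjective_iff_exists_right_inverse.1 hsurj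
  have h1 : ((X * B).transpose).det = 1 := by rw [hB]; simp
  have h2 : (X * B).transpose = fun k => ∑ j, B j k • X.transpose j := by
    ext k i
    simp [Matrix.mul_apply, mul_comm]
  have h3 : ((X * B).transpose).det = 0 := by
    rw [h2]
    change (Matrix.detRowAlternating (R := ℝ) (n := Fin r)).toMultilinearMap
      (fun k => ∑ j, B j k • X.transpose j) = 0
    rw [MultilinearMap.map_sum]
    refine Finset.sum_eq_zero fun σ _ => ?_
    rw [MultilinearMap.map_smul_univ]
    have : (Matrix.detRowAlternating (R := ℝ) (n := Fin r)).toMultilinearMap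
        (fun k => X.transpose (σ k)) = (X.submatrix id σ).transpose.det := rfl
    rw [this, Matrix.det_transpose, hcon, smul_zero]
  rw [h1] at h3
  exact one_ne_zero h3

lemma minorSum_pos {r m : ℕ} {X : Matrix (Fin r) (Fin m) ℝ} (hX : LinearIndependent ℝ X.row) :
    0 < minorSum X := by
  obtain ⟨σ, hσ⟩ := exists_minor_ne_zero hX
  exact (abs_pos.2 hσ).trans_le (abs_minor_le_minorSum X σ)

/-- The matrix sending an integer row `(a₀, …, aₙ)` to `(p * ∑ aⱼ gⱼ, q * a₁, …, q * aₙ)`. -/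
def flowMatrix {n : ℕ} (p q : ℝ) (g : Fin (n + 1) → ℝ) :
    Matrix (Fin (n + 1)) (Fin (n + 1)) ℝ :=
  Matrix.of fun i j => if j = 0 then p * g i else if i = j then q else 0

lemma mul_flowMatrix_zero {n r : ℕ} (p q : ℝ) (g : Fin (n + 1) → ℝ)
    (X : Matrix (Fin r) (Fin (n + 1)) ℝ) (i : Fin r) :
    (X * flowMatrix p q g) i 0 = p * ∑ j, g j * X i j := by
  simp only [Matrix.mul_apply, flowMatrix, Matrix.of_apply, if_true, Finset.mul_sum]
  exact Finset.sum_congr rfl fun j _ => by ring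

lemma mul_flowMatrix_of_ne {n r : ℕ} (p q : ℝ) (g : Fin (n + 1) → ℝ)
    (X : Matrix (Fin r) (Fin (n + 1)) ℝ) (i : Fin r) {j : Fin (n + 1)} (hj : j ≠ 0) :
    (X * flowMatrix p q g) i j = q * X i j := by
  simp [Matrix.mul_apply, flowMatrix, hj, mul_comm]

lemma det_submatrix_mul_flowMatrix {n r : ℕ} (p q : ℝ) (g : Fin (n + 1) → ℝ)
    (X : Matrix (Fin (r + 1)) (Fin (n + 1)) ℝ) {τ : Fin (r + 1) → Fin (n + 1)} {k₀ : Fin (r + 1)}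
    (hτ : ∀ k, k ≠ k₀ → τ k ≠ 0) :
    ((X * flowMatrix p q g).submatrix id (Function.update τ k₀ 0)).det =
      p * q ^ r * ∑ j, g j * (X.submatrix id (Function.update τ k₀ j)).det := by
  have h1 : (X * flowMatrix p q g).submatrix id (Function.update τ k₀ 0) =
      (X.submatrix id τ).updateCol k₀ (∑ j, g j • fun i => X i j) *
        Matrix.diagonal (Function.update (fun _ => q) k₀ p) := by
    ext i k
    rw [Matrix.mul_diagonal, Matrix.submatrix_apply, id]
    by_cases hk : k = k₀
    · subst hk
      rw [Function.update_self, mul_flowMatrix_zero]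
      simp [mul_comm]
    · rw [Function.update_of_ne hk, mul_flowMatrix_of_ne _ _ _ _ _ (hτ k hk)]
      simp [hk, mul_comm]
  have h2 : ∀ j, (X.submatrix id τ).updateCol k₀ (fun i => X i j) =
      X.submatrix id (Function.update τ k₀ j) := by
    intro j
    ext i k
    by_cases hk : k = k₀
    · subst hk; simp
    · simp [hk]
  rw [h1, Matrix.det_mul, Matrix.det_diagonal, ← Matrix.cramer_apply, map_sum]
  simp only [Finset.sum_apply, map_smul, Pi.smul_apply, Matrix.cramer_apply, h2, smul_eq_mul]
  rw [Finset.prod_update_of_mem (Finset.mem_univ k₀)]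
  simp [Finset.card_sdiff]
  ring

lemma exists_minor_mul_flowMatrix_eq {n r : ℕ} (p q : ℝ) (X : Matrix (Fin r) (Fin (n + 1)) ℝ)
    (σ : Fin r → Fin (n + 1)) : ∃ c : Fin (n + 1) → ℝ, ∀ g : Fin (n + 1) → ℝ, g 0 = 1 →
      ((X * flowMatrix p q g).submatrix id σ).det = ∑ j, c j * g j := by
  by_cases h : ∃ k₀, σ k₀ = 0
  · obtain ⟨k₀, hk₀⟩ := h
    obtain ⟨r, rfl⟩ : ∃ r', r = r' + 1 := ⟨r - 1, by have := k₀.isLt; omega⟩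
    by_cases hu : ∀ k, k ≠ k₀ → σ k ≠ 0
    · refine ⟨fun j => p * q ^ r * (X.submatrix id (Function.update σ k₀ j)).det, fun g _ => ?_⟩
      have := det_submatrix_mul_flowMatrix p q g X hu
      rw [← hk₀, Function.update_eq_self] at this
      rw [this, Finset.mul_sum]
      exact Finset.sum_congr rfl fun j _ => by ring
    · push Not at hu
      obtain ⟨k, hk, hk0⟩ := hu
      refine ⟨0, fun g _ => ?_⟩
      rw [Matrix.det_zero_of_column_eq hk fun i => by simp [hk0, hk₀]]
      simp
  · push Not at h
    refine ⟨Pi.single 0 (q • X.submatrix id σ).det, fun g hg => ?_⟩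
    have : (X * flowMatrix p q g).submatrix id σ = q • X.submatrix id σ := by
      ext i k
      simp [mul_flowMatrix_of_ne _ _ _ _ _ (h k)]
    rw [this, Finset.sum_eq_single 0] <;> simp +contextual [hg]

/-- The rows of `M` form an integer basis of `W` with the least possible sum of minors. -/
def IsMinimalBasis {m r : ℕ} (W : Submodule ℝ (Fin m → ℝ)) (M : Matrix (Fin r) (Fin m) ℤ) : Prop :=
  LinearIndependent ℝ (M.map (Int.cast : ℤ → ℝ)).row ∧
    Submodule.span ℝ (range (M.map (Int.cast : ℤ → ℝ)).row) = W ∧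
    ∀ M' : Matrix (Fin r) (Fin m) ℤ, LinearIndependent ℝ (M'.map (Int.cast : ℤ → ℝ)).row →
      Submodule.span ℝ (range (M'.map (Int.cast : ℤ → ℝ)).row) = W →
      minorSum (M.map (Int.cast : ℤ → ℝ)) ≤ minorSum (M'.map (Int.cast : ℤ → ℝ))

lemma minorSum_map_intCast {m r : ℕ} (M : Matrix (Fin r) (Fin m) ℤ) :
    minorSum (M.map (Int.cast : ℤ → ℝ)) =
      ((∑ σ : Fin r → Fin m, (M.submatrix id σ).det.natAbs : ℕ) : ℝ) := by
  rw [minorSum]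
  push_cast
  refine Finset.sum_congr rfl fun σ _ => ?_
  rw [Nat.cast_natAbs, Int.cast_abs, Int.cast_det]
  rfl

lemma exists_isMinimalBasis {m : ℕ} (A : Set (Fin m → ℤ)) :
    ∃ (r : ℕ) (M : Matrix (Fin r) (Fin m) ℤ),
      IsMinimalBasis (Submodule.span ℝ ((fun v j => (v j : ℝ)) '' A)) M := by
  classical
  set W := Submodule.span ℝ ((fun (v : Fin m → ℤ) j => (v j : ℝ)) '' A) with hW
  obtain ⟨b, hbA, hspan, hli⟩ := exists_linearIndependent ℝ
    ((fun (v : Fin m → ℤ) j => (v j : ℝ)) '' A)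
  have hfin : b.Finite := hli.setFinite
  have := hfin.fintype
  let e := (Fintype.equivFin b).symm
  choose w _ hw using fun x : b => hbA x.2
  have hrow : (Matrix.map (fun i => w (e i)) (Int.cast : ℤ → ℝ)).row =
      fun i => (e i : Fin m → ℝ) := funext fun i => hw (e i)
  have hex : ∃ N : ℕ, ∃ M : Matrix (Fin (Fintype.card b)) (Fin m) ℤ,
      LinearIndependent ℝ (M.map (Int.cast : ℤ → ℝ)).row ∧
      Submodule.span ℝ (range (M.map (Int.cast : ℤ → ℝ)).row) = W ∧
      ∑ σ : Fin (Fintype.card b) → Fin m, (M.submatrix id σ).det.natAbs = N := by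
    refine ⟨_, fun i => w (e i), ?_, ?_, rfl⟩
    · rw [hrow]; exact hli.comp e e.injective
    · rw [hrow, hW, ← hspan]
      congr 1
      rw [show (fun i => (e i : Fin m → ℝ)) = Subtype.val ∘ e from rfl, e.surjective.range_comp,
        Subtype.range_coe]
  obtain ⟨M, h1, h2, h3⟩ := Nat.find_spec hex
  refine ⟨_, M, h1, h2, fun M' h1' h2' => ?_⟩
  rw [minorSum_map_intCast, minorSum_map_intCast, h3]
  exact_mod_cast Nat.find_min' hex ⟨M', h1', h2', rfl⟩

lemma IsMinimalBasis.minorSum_mul_le {m r r' : ℕ} {W : Submodule ℝ (Fin m → ℝ)}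
    {M : Matrix (Fin r) (Fin m) ℤ} (hM : IsMinimalBasis W M) {M' : Matrix (Fin r') (Fin m) ℤ}
    (hli : LinearIndependent ℝ (M'.map (Int.cast : ℤ → ℝ)).row)
    (hspan : Submodule.span ℝ (range (M'.map (Int.cast : ℤ → ℝ)).row) = W)
    (Y : Matrix (Fin m) (Fin m) ℝ) :
    minorSum (M.map (Int.cast : ℤ → ℝ) * Y) ≤ minorSum (M'.map (Int.cast : ℤ → ℝ) * Y) := by
  obtain ⟨h1, h2, h3⟩ := hM
  have hr : r = r' := by
    have e1 := finrank_span_eq_card h1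
    have e2 := finrank_span_eq_card hli
    rw [h2] at e1
    rw [hspan] at e2
    simpa using e1.symm.trans e2
  subst hr
  have hA : ∀ i, ∃ c : Fin r → ℝ, ∑ k, c k • (M.map (Int.cast : ℤ → ℝ)).row k =
      (M'.map (Int.cast : ℤ → ℝ)).row i := by
    intro i
    refine (Submodule.mem_span_range_iff_exists_fun ℝ (v := (M.map (Int.cast : ℤ → ℝ)).row)).1 ?_
    rw [h2, ← hspan]
    exact Submodule.subset_span (mem_range_self i)
  choose A hA using hA
  have hM' : M'.map (Int.cast : ℤ → ℝ) = Matrix.of A * M.map (Int.cast : ℤ → ℝ) := by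
    ext i j
    have := congrFun (hA i) j
    simp only [Finset.sum_apply, Pi.smul_apply, smul_eq_mul, Matrix.row] at this
    rw [← this, Matrix.mul_apply]
    rfl
  have hge := h3 M' hli hspan
  have hpos := minorSum_pos h1
  rw [hM', minorSum_mul] at hge
  rw [hM', Matrix.mul_assoc, minorSum_mul]
  have : 1 ≤ |(Matrix.of A).det| := by
    by_contra! hlt
    nlinarith
  exact le_mul_of_one_le_left (minorSum_nonneg _) this

lemma exists_int_combination_le_minorSum {n r : ℕ} {M : Matrix (Fin (r + 1)) (Fin (n + 1)) ℤ}
    (hM : LinearIndependent ℝ (M.map (Int.cast : ℤ → ℝ)).row) :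
    ∃ c : Fin (n + 1) → ℤ, c ≠ 0 ∧ r ≤ n ∧ (r = n → ∀ j, j ≠ 0 → c j = 0) ∧
      ∀ (p q : ℝ) (g : Fin (n + 1) → ℝ), |p * q ^ r| * |∑ j, c j * g j| ≤
        minorSum (M.map (Int.cast : ℤ → ℝ) * flowMatrix p q g) := by
  obtain ⟨τ, hτ⟩ := exists_minor_ne_zero hM
  have hinj : Function.Injective τ := by
    intro k k' hkk
    by_contra hne
    exact hτ (Matrix.det_zero_of_column_eq hne fun i => by simp [hkk])
  have hrn : r ≤ n := by
    have := Fintype.card_le_of_injective τ hinj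
    simp at this
    omega
  obtain ⟨k₀, hk₀⟩ : ∃ k₀, ∀ k, k ≠ k₀ → τ k ≠ 0 := by
    by_cases h : ∃ k₀, τ k₀ = 0
    · obtain ⟨k₀, hk₀⟩ := h
      exact ⟨k₀, fun k hk h0 => hk (hinj (h0.trans hk₀.symm))⟩
    · push Not at h
      exact ⟨0, fun k _ => h k⟩
  have hcast : ∀ σ : Fin (r + 1) → Fin (n + 1),
      (((M.submatrix id σ).det : ℤ) : ℝ) = ((M.map (Int.cast : ℤ → ℝ)).submatrix id σ).det := by
    intro σ
    rw [Int.cast_det]; rfl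
  refine ⟨fun j => (M.submatrix id (Function.update τ k₀ j)).det, ?_, hrn, ?_, ?_⟩
  · intro h0
    have := congrFun h0 (τ k₀)
    simp only [Function.update_eq_self, Pi.zero_apply] at this
    rw [← hcast, this] at hτ
    simp at hτ
  · rintro rfl j hj
    have hsurj : Function.Surjective τ := Finite.surjective_of_injective hinj
    have hτ0 : τ k₀ = 0 := by
      obtain ⟨k, hk⟩ := hsurj 0
      by_cases hkk : k = k₀
      · exact hkk ▸ hk
      · exact absurd hk (hk₀ k hkk)
    obtain ⟨k, hk⟩ := hsurj j
    have hkk : k ≠ k₀ := by rintro rfl; exact hj (hk ▸ hτ0)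
    exact Matrix.det_zero_of_column_eq hkk fun i => by simp [hkk, hk]
  · intro p q g
    refine le_trans (le_of_eq ?_) (abs_minor_le_minorSum _ (Function.update τ k₀ 0))
    rw [det_submatrix_mul_flowMatrix p q g _ hk₀, ← abs_mul]
    congr 2
    refine Finset.sum_congr rfl fun j _ => ?_
    rw [hcast, mul_comm]

/-- The real span of a set of integer vectors. -/
def intSpan {m : ℕ} (A : Set (Fin m → ℤ)) : Submodule ℝ (Fin m → ℝ) :=
  Submodule.span ℝ ((fun v j => (v j : ℝ)) '' A)

lemma cons_map_intCast_mul {m r : ℕ} (v : Fin m → ℤ) (M : Matrix (Fin r) (Fin m) ℤ)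
    (Y : Matrix (Fin m) (Fin m) ℝ) :
    (Matrix.map (Matrix.of (Fin.cons v M : Fin (r + 1) → Fin m → ℤ)) (Int.cast : ℤ → ℝ)) * Y =
      Matrix.of (Fin.cons (Matrix.vecMul (fun j => (v j : ℝ)) Y)
        (M.map (Int.cast : ℤ → ℝ) * Y) : Fin (r + 1) → Fin m → ℝ) := by
  ext i j
  refine Fin.cases ?_ (fun i => ?_) i
  · rw [Matrix.mul_apply]; rfl
  · rw [Matrix.mul_apply]; rfl

lemma row_cons_map_intCast {m r : ℕ} (v : Fin m → ℤ) (M : Matrix (Fin r) (Fin m) ℤ) :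
    (Matrix.map (Matrix.of (Fin.cons v M : Fin (r + 1) → Fin m → ℤ)) (Int.cast : ℤ → ℝ)).row =
      (Fin.cons (fun j => (v j : ℝ)) (M.map (Int.cast : ℤ → ℝ)).row :
        Fin (r + 1) → Fin m → ℝ) := by
  funext i
  refine Fin.cases ?_ (fun i => ?_) i <;> rfl

/-- There is no short vector at a marked point. -/
lemma IsMarked.not_short {m : ℕ} {V : Set (Fin m → ℤ)} {S : Finset (Submodule ℝ (Fin m → ℝ))}
    (hS : ∀ W, W ∈ S ↔ W ≠ ⊥ ∧ ∃ A ⊆ V, W = intSpan A)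
    {ψ : Submodule ℝ (Fin m → ℝ) → ℝ → ℝ} {Y : Matrix (Fin m) (Fin m) ℝ} {x ε ε' : ℝ}
    (hψ : ∀ W ∈ S, ∃ (r : ℕ) (M : Matrix (Fin r) (Fin m) ℤ), IsMinimalBasis W M ∧
      ψ W x = minorSum (M.map (Int.cast : ℤ → ℝ) * Y))
    (hmark : IsMarked ψ ε' 1 S x) (hε0 : 0 ≤ ε) (hε : (m : ℝ) ^ m * (m * ε) ≤ ε') (hε' : ε' < 1)
    {v : Fin m → ℤ} (hv : v ∈ V) (hv0 : v ≠ 0) :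
    ∃ j, ε < |Matrix.vecMul (fun j => (v j : ℝ)) Y j| := by
  classical
  by_contra! hshort
  obtain ⟨F, hFS, hchain, hF1, hF2⟩ := hmark
  set w : Fin m → ℝ := fun j => (v j : ℝ) with hw
  have hw0 : w ≠ 0 := by
    intro h
    apply hv0
    funext j
    have := congrFun h j
    simpa [hw] using this
  have hW₀ : ∃ A₀ ⊆ V, w ∉ intSpan A₀ ∧
      (∃ (r : ℕ) (M : Matrix (Fin r) (Fin m) ℤ), IsMinimalBasis (intSpan A₀) M ∧
        minorSum (M.map (Int.cast : ℤ → ℝ) * Y) ≤ 1) ∧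
      (∀ W ∈ F, w ∉ W → W ≤ intSpan A₀) ∧ (∀ W ∈ F, w ∈ W → intSpan A₀ ≤ W) := by
    rcases (F.filter fun W => w ∉ W).eq_empty_or_nonempty with he | hne
    · have hbot : intSpan (∅ : Set (Fin m → ℤ)) = ⊥ := by simp [intSpan]
      refine ⟨∅, empty_subset _, ?_, ⟨0, Matrix.of Fin.elim0, ⟨?_, ?_, ?_⟩, ?_⟩, ?_, ?_⟩
      · rwa [hbot, Submodule.mem_bot]
      · exact linearIndependent_empty_type
      · rw [hbot, range_eq_empty, Submodule.span_empty]
      · intro M' _ _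
        rw [Subsingleton.elim M' (Matrix.of Fin.elim0)]
      · simp [minorSum]
      · intro W hW hwW
        rw [Finset.filter_eq_empty_iff] at he
        exact absurd hwW (he hW)
      · intro W _ _
        rw [hbot]; exact bot_le
    · obtain ⟨W₀, hW₀⟩ := Finset.exists_maximal hne
      have hmem := Finset.mem_filter.1 hW₀.1
      have hgt : ∀ W ∈ F, w ∉ W → W ≤ W₀ := by
        intro W hW hwW
        rcases hchain.total hW hmem.1 with h | h
        · exact h
        · exact hW₀.2 (Finset.mem_filter.2 ⟨hW, hwW⟩) h
      obtain ⟨A₀, hA₀, hWA⟩ := ((hS W₀).1 (hFS hmem.1)).2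
      obtain ⟨r, M, hM, hψM⟩ := hψ W₀ (hFS hmem.1)
      refine ⟨A₀, hA₀, hWA ▸ hmem.2, ⟨r, M, hWA ▸ hM, ?_⟩, fun W hW hwW => hWA ▸ hgt W hW hwW, ?_⟩
      · rw [← hψM]; exact (hF1 W₀ hmem.1).2.le
      · intro W hW hwW
        rw [← hWA]
        rcases hchain.total hW hmem.1 with h | h
        · exact absurd (h hwW) hmem.2
        · exact h
  obtain ⟨A₀, hA₀, hwA, ⟨r, M, hM, hle⟩, hlow, hhigh⟩ := hW₀
  set Δ := intSpan (insert v A₀) with hΔ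
  have hΔsup : Δ = Submodule.span ℝ {w} ⊔ intSpan A₀ := by
    rw [hΔ, intSpan, image_insert_eq, Submodule.span_insert]
    rfl
  have hwΔ : w ∈ Δ := Submodule.subset_span (mem_image_of_mem _ (mem_insert v A₀))
  have hΔS : Δ ∈ S := by
    refine (hS Δ).2 ⟨fun h => hw0 ?_, insert v A₀, insert_subset hv hA₀, rfl⟩
    rw [h] at hwΔ
    simpa using hwΔ
  obtain ⟨r', M', hM', hψM'⟩ := hψ Δ hΔS
  have hrow := row_cons_map_intCast v M
  have hli : LinearIndependent ℝ
      (Matrix.map (Matrix.of (Fin.cons v M : Fin (r + 1) → Fin m → ℤ)) (Int.cast : ℤ → ℝ)).row := by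
    rw [hrow]
    refine linearIndependent_finCons.2 ⟨hM.1, ?_⟩
    rw [hM.2.1]; exact hwA
  have hspan : Submodule.span ℝ (range
      (Matrix.map (Matrix.of (Fin.cons v M : Fin (r + 1) → Fin m → ℤ)) (Int.cast : ℤ → ℝ)).row) =
      Δ := by
    rw [hrow, Fin.range_cons, Submodule.span_insert, hM.2.1, hΔsup]
  have hrm : r + 1 ≤ m := by
    have := hli.fintype_card_le_finrank
    simpa using this
  have hm1 : (1 : ℝ) ≤ m := by exact_mod_cast (by omega : 1 ≤ m)
  have hψΔ : ψ Δ x ≤ ε' := by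
    rw [hψM']
    refine (hM'.minorSum_mul_le hli hspan Y).trans ?_
    rw [cons_map_intCast_mul]
    refine (minorSum_cons_le _ _ hshort).trans (le_trans ?_ hε)
    have h1 : (m : ℝ) ^ (r + 1) ≤ m ^ m := pow_le_pow_right₀ hm1 hrm
    have h2 : (r : ℝ) + 1 ≤ m := by exact_mod_cast hrm
    have h3 : ε * minorSum (M.map (Int.cast : ℤ → ℝ) * Y) ≤ ε := mul_le_of_le_one_right hε0 hle
    have h4 := mul_nonneg hε0 (minorSum_nonneg (M.map (Int.cast : ℤ → ℝ) * Y))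
    gcongr
  by_cases hΔF : Δ ∈ F
  · exact absurd (hF1 Δ hΔF).1 (not_lt.2 hψΔ)
  · have := hF2 Δ hΔS hΔF fun W hW => by
      by_cases hwW : w ∈ W
      · left
        rw [hΔsup, sup_le_iff, Submodule.span_le]
        exact ⟨by simpa using hwW, hhigh W hW hwW⟩
      · right
        rw [hΔsup]
        exact (hlow W hW hwW).trans le_sup_right
    linarith

/-- The quantitative nondivergence bound for the set of points with a short integer vector. -/
lemma volume_exists_short_le {n : ℕ} {g : ℝ → Fin (n + 1) → ℝ} {u v η κ t ε ε' : ℝ} {θ : ENNReal}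
    (hg0 : ∀ x, g x 0 = 1) (hg : ∀ j, ContinuousOn (fun x => g x j) (Icc u v))
    (hη : 0 < η)
    (hgood : ∀ (c : Fin (n + 1) → ℝ) (s u' v' : ℝ), u' < v' → Icc u' v' ⊆ Icc u v →
      ∀ y ∈ Icc u' v', 0 < |∑ j, c j * g y j| → s ≤ η * |∑ j, c j * g y j| →
      volume {x ∈ Icc u' v' | |∑ j, c j * g x j| ≤ s} ≤ θ * volume (Icc u' v'))
    (huv : u ≤ v)
    (hκ : ∀ c : Fin (n + 1) → ℤ, c ≠ 0 → ∃ y ∈ Icc u v, κ ≤ |∑ j, c j * g y j|)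
    (ht : 1 ≤ t) (htκ : 1 ≤ t * κ) (hε0 : 0 ≤ ε)
    (hε : ((n + 1 : ℕ) : ℝ) ^ (n + 1) * ((n + 1 : ℕ) * ε) ≤ ε') (hε'1 : ε' < 1)
    (hε'η : ((n + 1 : ℕ) : ℝ) ^ (n + 1) * ε' ≤ η) {V : Set (Fin (n + 1) → ℤ)} (hV : V.Finite) :
    volume {x ∈ Icc u v | ∃ c ∈ V, c ≠ 0 ∧ ∀ j,
      |Matrix.vecMul (fun j => (c j : ℝ)) (flowMatrix (t ^ n) t⁻¹ (g x)) j| ≤ ε} ≤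
      nondivConst θ (n + 1) * volume (Icc u v) := by
  classical
  have ht0 : 0 < t := by linarith
  have hSfin : {W : Submodule ℝ (Fin (n + 1) → ℝ) | W ≠ ⊥ ∧ ∃ A ⊆ V, W = intSpan A}.Finite := by
    refine (hV.finite_subsets.image intSpan).subset ?_
    rintro W ⟨-, A, hA, rfl⟩
    exact mem_image_of_mem _ hA
  let S := hSfin.toFinset
  have hS : ∀ W, W ∈ S ↔ W ≠ ⊥ ∧ ∃ A ⊆ V, W = intSpan A := fun W => hSfin.mem_toFinset
  have hbasis : ∀ W : Submodule ℝ (Fin (n + 1) → ℝ), ∃ (r : ℕ) (M : Matrix (Fin r) (Fin (n + 1)) ℤ),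
      W ∈ S → IsMinimalBasis W M := by
    intro W
    by_cases hW : W ∈ S
    · obtain ⟨-, A, -, rfl⟩ := (hS W).1 hW
      obtain ⟨r, M, hM⟩ := exists_isMinimalBasis A
      exact ⟨r, M, fun _ => hM⟩
    · exact ⟨0, Matrix.of Fin.elim0, fun h => absurd h hW⟩
  choose r M hM using hbasis
  let ψ : Submodule ℝ (Fin (n + 1) → ℝ) → ℝ → ℝ := fun W x =>
    minorSum ((M W).map (Int.cast : ℤ → ℝ) * flowMatrix (t ^ n) t⁻¹ (g x))
  have hminor : ∀ W, ∀ σ : Fin (r W) → Fin (n + 1), ∃ c : Fin (n + 1) → ℝ, ∀ x,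
      (((M W).map (Int.cast : ℤ → ℝ) * flowMatrix (t ^ n) t⁻¹ (g x)).submatrix id σ).det =
        ∑ j, c j * g x j := by
    intro W σ
    obtain ⟨c, hc⟩ := exists_minor_mul_flowMatrix_eq (t ^ n) t⁻¹ ((M W).map (Int.cast : ℤ → ℝ)) σ
    exact ⟨c, fun x => hc (g x) (hg0 x)⟩
  have hrank : ∀ W ∈ S, Module.finrank ℝ W = r W := by
    intro W hW
    have := finrank_span_eq_card (hM W hW).1
    rw [(hM W hW).2.1] at this
    simpa using this
  have hrpos : ∀ W ∈ S, 1 ≤ r W := by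
    intro W hW
    rw [← hrank W hW]
    exact Submodule.one_le_finrank_iff.2 ((hS W).1 hW).1
  have hrle : ∀ W ∈ S, r W ≤ n + 1 := by
    intro W hW
    rw [← hrank W hW]
    simpa using Submodule.finrank_le W
  have hmark := volume_not_isMarked_le (ψ := ψ) (ε := ε') (ρ := 1) (θ := θ)
    (Submodule.finrank_strictMono (K := ℝ) (V := Fin (n + 1) → ℝ)) (n + 1) (S := S) (u := u) (v := v)
    ?_ ?_ ?_ ?_
  · refine (measure_mono ?_).trans hmark
    rintro x ⟨hx, c, hc, hc0, hshort⟩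
    refine ⟨hx, fun h => ?_⟩
    obtain ⟨j, hj⟩ := h.not_short hS (fun W hW => ⟨r W, M W, hM W hW, rfl⟩) hε0 hε hε'1 hc hc0
    exact absurd (hshort j) (not_le.2 hj)
  · have : S.image (fun W : Submodule ℝ (Fin (n + 1) → ℝ) => Module.finrank ℝ W) ⊆
        Finset.Icc 1 (n + 1) := by
      intro k hk
      obtain ⟨W, hW, rfl⟩ := Finset.mem_image.1 hk
      rw [Finset.mem_Icc, hrank W hW]
      exact ⟨hrpos W hW, hrle W hW⟩
    simpa using Finset.card_le_card this
  · intro W _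
    refine continuousOn_finsetSum _ fun σ _ => ?_
    obtain ⟨c, hc⟩ := hminor W σ
    simp only [hc]
    exact (continuousOn_finsetSum _ fun j _ => continuousOn_const.mul (hg j)).abs
  · rintro W hW u' v' huv' hsub ⟨y, hy, hyW⟩
    have hN1 : (1 : ℝ) ≤ ((n + 1 : ℕ) : ℝ) := by exact_mod_cast (by omega : 1 ≤ n + 1)
    set N : ℝ := ((n + 1 : ℕ) : ℝ) ^ (n + 1) with hN
    have hN0 : 0 < N := by positivity
    obtain ⟨σ, hσ⟩ : ∃ σ : Fin (r W) → Fin (n + 1), 1 / N ≤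
        |(((M W).map (Int.cast : ℤ → ℝ) * flowMatrix (t ^ n) t⁻¹ (g y)).submatrix id σ).det| := by
      by_contra! hcon
      have hne : (Finset.univ : Finset (Fin (r W) → Fin (n + 1))).Nonempty :=
        ⟨fun _ => 0, Finset.mem_univ _⟩
      have hlt := Finset.sum_lt_sum_of_nonempty hne fun σ _ => hcon σ
      have hle : ∑ _σ : Fin (r W) → Fin (n + 1), 1 / N ≤ 1 := by
        rw [Finset.sum_const, nsmul_eq_mul, mul_one_div, div_le_one hN0]
        simp only [Finset.card_univ, Fintype.card_fun, Fintype.card_fin]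
        rw [hN, Nat.cast_pow]
        exact pow_le_pow_right₀ hN1 (hrle W hW)
      exact absurd hyW (not_le.2 (hlt.trans_le hle))
    obtain ⟨c, hc⟩ := hminor W σ
    rw [hc] at hσ
    refine (measure_mono ?_).trans (hgood c ε' u' v' huv' hsub y hy
      (lt_of_lt_of_le (by positivity) hσ) ?_)
    · rintro x ⟨hx, hxW⟩
      refine ⟨hx, ?_⟩
      rw [← hc]
      exact (abs_minor_le_minorSum _ σ).trans hxW
    · have h1 : ε' ≤ η * (1 / N) := by
        rw [mul_one_div, le_div_iff₀ hN0, mul_comm]; exact hε'η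
      exact h1.trans (mul_le_mul_of_nonneg_left hσ hη.le)
  · intro W hW
    obtain ⟨r', hr'⟩ : ∃ r', r W = r' + 1 := ⟨r W - 1, by have := hrpos W hW; omega⟩
    have key : ∀ (k : ℕ) (X : Matrix (Fin k) (Fin (n + 1)) ℤ), k = r' + 1 →
        LinearIndependent ℝ (X.map (Int.cast : ℤ → ℝ)).row → ∃ y ∈ Icc u v,
          1 ≤ minorSum (X.map (Int.cast : ℤ → ℝ) * flowMatrix (t ^ n) t⁻¹ (g y)) := by
      rintro k X rfl hX
      obtain ⟨c, hc0, hrn, hctop, hle⟩ := exists_int_combination_le_minorSum hX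
      have hscale : |t ^ n * t⁻¹ ^ r'| = t ^ (n - r') := by
        rw [abs_of_pos (by positivity), inv_pow, ← div_eq_mul_inv, div_eq_iff (by positivity),
          ← pow_add, Nat.sub_add_cancel hrn]
      rcases hrn.lt_or_eq with hlt | heq
      · obtain ⟨y, hy, hyκ⟩ := hκ c hc0
        refine ⟨y, hy, le_trans ?_ (hle (t ^ n) t⁻¹ (g y))⟩
        rw [hscale]
        have h1 : t ≤ t ^ (n - r') := le_self_pow₀ ht (by omega)
        calc (1 : ℝ) ≤ t * κ := htκ
          _ ≤ t * |∑ j, c j * g y j| := by gcongr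
          _ ≤ t ^ (n - r') * |∑ j, c j * g y j| := by gcongr
      · refine ⟨u, left_mem_Icc.2 huv, le_trans ?_ (hle (t ^ n) t⁻¹ (g u))⟩
        have hz := hctop heq
        rw [hscale, heq, Nat.sub_self, pow_zero, one_mul, Finset.sum_eq_single 0
          (fun j _ hj => by simp [hz j hj]) (by simp), hg0, mul_one]
        have hc00 : c 0 ≠ 0 := by
          intro h
          refine hc0 (funext fun j => ?_)
          by_cases hj : j = 0
          · rw [hj, h]; rfl
          · exact hz j hj
        exact_mod_cast Int.one_le_abs hc00
    exact key (r W) (M W) hr' (hM W hW).1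

lemma exists_nondivConst_le (m : ℕ) :
    ∃ θ : ℝ, 0 < θ ∧ θ ≤ 1 ∧ nondivConst (ENNReal.ofReal θ) m ≤ 1 / 4 := by
  have key : ∀ (θ : ENNReal) (k : ℕ), nondivConst θ k ≤ 4 ^ k * θ := by
    intro θ k
    induction k with
    | zero => simp [nondivConst]
    | succ k ih =>
      have h1 : (1 : ENNReal) ≤ 4 ^ k := one_le_pow₀ (by norm_num)
      calc nondivConst θ (k + 1) = 2 * (θ + nondivConst θ k) := rfl
        _ ≤ 2 * (4 ^ k * θ + 4 ^ k * θ) := by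
          gcongr
          exact le_mul_of_one_le_left (zero_le) h1
        _ = 4 ^ (k + 1) * θ := by ring
  have h4 : (1 : ℝ) ≤ 4 ^ m := one_le_pow₀ (by norm_num)
  refine ⟨1 / (4 * 4 ^ m), by positivity, ?_, (key _ m).trans ?_⟩
  · rw [div_le_one (by positivity)]; linarith
  · rw [show (4 : ENNReal) ^ m = ENNReal.ofReal (4 ^ m) by
        rw [ENNReal.ofReal_pow (by norm_num)]; norm_num,
      ← ENNReal.ofReal_mul (by positivity),
      show (4 : ℝ) ^ m * (1 / (4 * 4 ^ m)) = 1 / 4 by field_simp,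
      ENNReal.ofReal_div_of_pos (by norm_num)]
    norm_num

lemma DerivChain.mono {G : ℕ → ℝ → ℝ} {k k' : ℕ} {a b a' b' : ℝ} (hG : DerivChain G k a b)
    (hk : k' ≤ k) (hab : Icc a' b' ⊆ Icc a b) : DerivChain G k' a' b' := by
  intro j hj
  obtain ⟨h1, h2⟩ := hG j (by omega)
  have h3 : Ioo a' b' ⊆ Ioo a b := by
    rw [← interior_Icc, ← interior_Icc]; exact interior_mono hab
  exact ⟨h1.mono hab, fun x hx => h2 x (h3 hx)⟩

/-- The `k`-th derivative on `[a, b]` of the combination `c₀ + ∑ cᵢ fᵢ`. -/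
noncomputable def combDeriv {n : ℕ} (f : Fin n → ℝ → ℝ) (a b : ℝ) (c : Fin (n + 1) → ℝ) (k : ℕ)
    (x : ℝ) : ℝ :=
  (if k = 0 then c 0 else 0) + ∑ i, c i.succ * iteratedDerivWithin k (f i) (Icc a b) x

lemma combDeriv_zero {n : ℕ} (f : Fin n → ℝ → ℝ) (a b : ℝ) (c : Fin (n + 1) → ℝ) (x : ℝ) :
    combDeriv f a b c 0 x = c 0 + ∑ i, c i.succ * f i x := by
  simp [combDeriv]

lemma derivChain_combDeriv {n : ℕ} {f : Fin n → ℝ → ℝ} {a b : ℝ} (hab : a < b)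
    (hf : ∀ i, ContDiffOn ℝ n (f i) (Icc a b)) (c : Fin (n + 1) → ℝ) :
    DerivChain (combDeriv f a b c) n a b := by
  intro j hj
  have hU := uniqueDiffOn_Icc hab
  have hj' : (j : WithTop ℕ∞) < n := by exact_mod_cast hj
  refine ⟨continuousOn_const.add (continuousOn_finsetSum _ fun i _ => continuousOn_const.mul
    ((hf i).continuousOn_iteratedDerivWithin hj'.le hU)), fun x hx => ?_⟩
  have hnhds : Icc a b ∈ nhds x := Icc_mem_nhds hx.1 hx.2
  have key : ∀ i, HasDerivAt (iteratedDerivWithin j (f i) (Icc a b))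
      (iteratedDerivWithin (j + 1) (f i) (Icc a b) x) x := by
    intro i
    rw [iteratedDerivWithin_succ]
    exact (((hf i).differentiableOn_iteratedDerivWithin hj' hU) x
      (Ioo_subset_Icc_self hx)).hasDerivWithinAt.hasDerivAt hnhds
  have := HasDerivAt.fun_sum (u := Finset.univ) fun i _ => (key i).const_mul (c i.succ)
  refine (this.const_add (if j = 0 then c 0 else 0)).congr_deriv ?_
  simp [combDeriv]

/-- A vector is controlled by the largest coordinate of its image under an invertible matrix. -/
lemma exists_pos_mul_sum_abs_le {n : ℕ} (hn : 1 ≤ n) {A : Matrix (Fin n) (Fin n) ℝ}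
    (hA : A.det ≠ 0) :
    ∃ m : ℝ, 0 < m ∧ ∀ c : Fin n → ℝ, ∃ k, m * ∑ i, |c i| ≤ |∑ i, c i * A i k| := by
  set M := ∑ i, ∑ j, |A⁻¹ j i| with hM
  have hM0 : 0 ≤ M := Finset.sum_nonneg fun i _ => Finset.sum_nonneg fun j _ => abs_nonneg _
  refine ⟨1 / (1 + M), by positivity, fun c => ?_⟩
  have : Nonempty (Fin n) := ⟨⟨0, hn⟩⟩
  obtain ⟨k, hk⟩ := Finite.exists_max fun k => |Matrix.vecMul c A k|
  refine ⟨k, ?_⟩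
  change _ ≤ |Matrix.vecMul c A k|
  have hc : Matrix.vecMul (Matrix.vecMul c A) A⁻¹ = c := by
    rw [Matrix.vecMul_vecMul, Matrix.mul_nonsing_inv _ (isUnit_iff_ne_zero.2 hA),
      Matrix.vecMul_one]
  have hci : ∀ i, |c i| ≤ |Matrix.vecMul c A k| * ∑ j, |A⁻¹ j i| := by
    intro i
    calc |c i| = |∑ j, Matrix.vecMul c A j * A⁻¹ j i| := by
          exact congrArg abs (congrFun hc i).symm
      _ ≤ ∑ j, |Matrix.vecMul c A j * A⁻¹ j i| := Finset.abs_sum_le_sum_abs _ _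
      _ ≤ ∑ j, |Matrix.vecMul c A k| * |A⁻¹ j i| := by
          refine Finset.sum_le_sum fun j _ => ?_
          rw [abs_mul]
          exact mul_le_mul_of_nonneg_right (hk j) (abs_nonneg _)
      _ = _ := by rw [Finset.mul_sum]
  have hsum : ∑ i, |c i| ≤ |Matrix.vecMul c A k| * M := by
    rw [hM, Finset.mul_sum]
    exact Finset.sum_le_sum fun i _ => hci i
  rw [one_div_mul_eq_div, div_le_iff₀ (by positivity)]
  nlinarith [abs_nonneg (Matrix.vecMul c A k)]

/-- Near each point, every combination `c₀ + ∑ cᵢ fᵢ` of a nondegenerate family has a derivative of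
order between `1` and `n` which is almost constant and comparable with the coefficients. -/
lemma exists_combDeriv_almost_const {n : ℕ} (hn : 1 ≤ n) {a b : ℝ} (hab : a < b)
    {f : Fin n → ℝ → ℝ} (hf : ∀ i, ContDiffOn ℝ n (f i) (Icc a b)) {x₀ : ℝ} (hx₀ : x₀ ∈ Icc a b)
    (hW : (Matrix.of fun i j : Fin n =>
      iteratedDerivWithin ((j : ℕ) + 1) (f i) (Icc a b) x₀).det ≠ 0) :
    ∃ a' b' m : ℝ, Icc a' b' ⊆ Icc a b ∧ Icc a' b' ∈ nhdsWithin x₀ (Icc a b) ∧ 0 < m ∧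
      ∀ c : Fin (n + 1) → ℝ, ∃ (k : ℕ) (D : ℝ), 1 ≤ k ∧ k ≤ n ∧
        m * ∑ i : Fin n, |c i.succ| ≤ |D| ∧
        ∀ x ∈ Icc a' b', |combDeriv f a b c k x - D| ≤ |D| / 2 := by
  obtain ⟨m, hm, hmc⟩ := exists_pos_mul_sum_abs_le hn hW
  have hev : ∀ᶠ x in nhdsWithin x₀ (Icc a b), ∀ i j : Fin n,
      |iteratedDerivWithin ((j : ℕ) + 1) (f i) (Icc a b) x -
        iteratedDerivWithin ((j : ℕ) + 1) (f i) (Icc a b) x₀| < m / 2 := by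
    refine eventually_all.2 fun i => eventually_all.2 fun j => ?_
    have hj : (((j : ℕ) + 1 : ℕ) : WithTop ℕ∞) ≤ n := by
      exact_mod_cast (by omega : (j : ℕ) + 1 ≤ n)
    have := (hf i).continuousOn_iteratedDerivWithin hj (uniqueDiffOn_Icc hab) x₀ hx₀
    have h2 := Metric.tendsto_nhds.1 this (m / 2) (by positivity)
    simpa only [Real.dist_eq] using h2
  obtain ⟨r, hr, hball⟩ := Metric.mem_nhdsWithin_iff.1 hev
  have hI : Icc (max a (x₀ - r / 2)) (min b (x₀ + r / 2)) =
      Icc a b ∩ Icc (x₀ - r / 2) (x₀ + r / 2) := Icc_inter_Icc.symm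
  refine ⟨max a (x₀ - r / 2), min b (x₀ + r / 2), m, ?_, ?_, hm, fun c => ?_⟩
  · rw [hI]; exact inter_subset_left
  · rw [hI]
    exact inter_mem self_mem_nhdsWithin
      (mem_nhdsWithin_of_mem_nhds (Icc_mem_nhds (by linarith) (by linarith)))
  · obtain ⟨k, hk⟩ := hmc fun i => c i.succ
    refine ⟨k + 1, _, by omega, by omega, hk, fun x hx => ?_⟩
    rw [hI] at hx
    have hx' : x ∈ Metric.ball x₀ r ∩ Icc a b := by
      refine ⟨?_, hx.1⟩
      rw [Metric.mem_ball, Real.dist_eq, abs_lt]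
      constructor <;> linarith [hx.2.1, hx.2.2]
    have hclose := hball hx'
    have : combDeriv f a b c (k + 1) x - ∑ i : Fin n, c i.succ * (Matrix.of fun i j : Fin n =>
        iteratedDerivWithin ((j : ℕ) + 1) (f i) (Icc a b) x₀) i k =
        ∑ i : Fin n, c i.succ * (iteratedDerivWithin ((k : ℕ) + 1) (f i) (Icc a b) x -
          iteratedDerivWithin ((k : ℕ) + 1) (f i) (Icc a b) x₀) := by
      simp [combDeriv, mul_sub, Finset.sum_sub_distrib]
    rw [this]
    calc _ ≤ ∑ i : Fin n, |c i.succ * (iteratedDerivWithin ((k : ℕ) + 1) (f i) (Icc a b) x -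
          iteratedDerivWithin ((k : ℕ) + 1) (f i) (Icc a b) x₀)| := Finset.abs_sum_le_sum_abs _ _
      _ ≤ ∑ i : Fin n, |c i.succ| * (m / 2) := by
          refine Finset.sum_le_sum fun i _ => ?_
          rw [abs_mul]
          exact mul_le_mul_of_nonneg_left (hclose i k).le (abs_nonneg _)
      _ = (m * ∑ i : Fin n, |c i.succ|) / 2 := by rw [← Finset.sum_mul]; ring
      _ ≤ _ := by linarith

/-- Nonzero integer combinations are bounded below somewhere on a given interval. -/
lemma exists_le_abs_combDeriv_of_int {n : ℕ} {a b a' b' m : ℝ} {f : Fin n → ℝ → ℝ} (hab : a < b)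
    (hf : ∀ i, ContDiffOn ℝ n (f i) (Icc a b)) (hsub : Icc a' b' ⊆ Icc a b) (hm : 0 < m)
    (hder : ∀ c : Fin (n + 1) → ℝ, ∃ (k : ℕ) (D : ℝ), 1 ≤ k ∧ k ≤ n ∧
        m * ∑ i : Fin n, |c i.succ| ≤ |D| ∧
        ∀ x ∈ Icc a' b', |combDeriv f a b c k x - D| ≤ |D| / 2)
    {u v : ℝ} (huv : u < v) (hJ : Icc u v ⊆ Icc a' b') :
    ∃ κ : ℝ, 0 < κ ∧ ∀ c : Fin (n + 1) → ℤ, c ≠ 0 →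
      ∃ y ∈ Icc u v, κ ≤ |combDeriv f a b (fun j => (c j : ℝ)) 0 y| := by
  set h := min 1 ((v - u) / (n + 2)) with hh
  have hn2 : (0 : ℝ) < n + 2 := by positivity
  have hh0 : 0 < h := lt_min one_pos (div_pos (sub_pos.2 huv) hn2)
  have hh1 : h ≤ 1 := min_le_left _ _
  have hhv : h * (n + 2) ≤ v - u := (le_div_iff₀ hn2).1 (min_le_right _ _)
  set κ := min 1 (m * h ^ n / (4 * (n + 1).factorial)) with hκ
  have hfac : (0 : ℝ) < (n + 1).factorial := by exact_mod_cast Nat.factorial_pos _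
  have hκ0 : 0 < κ := lt_min one_pos (by positivity)
  refine ⟨κ, hκ0, fun c hc => ?_⟩
  by_cases hz : ∀ i : Fin n, c i.succ = 0
  · refine ⟨u, left_mem_Icc.2 huv.le, (min_le_left _ _).trans ?_⟩
    have hc0 : c 0 ≠ 0 := fun h0 => hc (funext fun j => Fin.cases h0 hz j)
    simp only [combDeriv_zero, hz]
    simpa using (by exact_mod_cast Int.one_le_abs hc0 : (1 : ℝ) ≤ |(c 0 : ℝ)|)
  · push Not at hz
    obtain ⟨i₀, hi₀⟩ := hz
    by_contra! hcon
    obtain ⟨k, D, hk1, hkn, hmD, hD⟩ := hder fun j => (c j : ℝ)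
    have hkn' : (k : ℝ) ≤ n := by exact_mod_cast hkn
    obtain ⟨t, htE, htc, hsep⟩ := exists_finset_separated hh0 k (isCompact_Icc (a := u) (b := v))
      (by
        rw [Real.volume_Icc]
        refine (ENNReal.ofReal_lt_ofReal_iff (sub_pos.2 huv)).2 ?_
        nlinarith)
    have hle := DerivChain.abs_le_of_separated
      ((derivChain_combDeriv hab hf fun j => (c j : ℝ)).mono hkn (hJ.trans hsub))
      (fun x hx => hD x (hJ hx)) htE hh0 htc hsep fun x hx => (hcon x (htE hx)).le
    have h1 : (1 : ℝ) ≤ ∑ i : Fin n, |(c i.succ : ℝ)| := by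
      have h2 : (1 : ℝ) ≤ |(c i₀.succ : ℝ)| := by exact_mod_cast Int.one_le_abs hi₀
      exact h2.trans (Finset.single_le_sum (f := fun i : Fin n => |(c i.succ : ℝ)|)
        (fun i _ => abs_nonneg _) (Finset.mem_univ i₀))
    have h3 : m ≤ |D| := (le_mul_of_one_le_right hm.le h1).trans hmD
    have h4 : (k.factorial : ℝ) * (k + 1) ≤ (n + 1).factorial := by
      have : k.factorial * (k + 1) ≤ (n + 1).factorial := by
        rw [mul_comm, ← Nat.factorial_succ]; exact Nat.factorial_le (by omega)
      exact_mod_cast this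
    have h5 : κ / h ^ k ≤ κ / h ^ n :=
      div_le_div_of_nonneg_left hκ0.le (by positivity) (pow_le_pow_of_le_one hh0.le hh1 hkn)
    have h6 : κ / h ^ n ≤ m / (4 * (n + 1).factorial) := by
      rw [div_le_iff₀ (by positivity)]
      refine (min_le_right _ _).trans (le_of_eq (by ring))
    have h7 : 2 * ((k.factorial : ℝ) * ((k + 1) * (κ / h ^ k))) ≤ m / 2 := by
      calc 2 * ((k.factorial : ℝ) * ((k + 1) * (κ / h ^ k)))
          = 2 * ((k.factorial * (k + 1)) * (κ / h ^ k)) := by ring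
        _ ≤ 2 * ((n + 1).factorial * (m / (4 * (n + 1).factorial))) := by
            refine mul_le_mul_of_nonneg_left (mul_le_mul h4 (h5.trans h6) ?_ hfac.le) zero_le_two
            positivity
        _ = m / 2 := by field_simp; norm_num
    linarith

/-- The integer vectors with coefficients bounded by `T` form a finite set. -/
lemma finite_setOf_abs_intCast_le (m : ℕ) (T : ℝ) :
    {c : Fin m → ℤ | ∀ j, |(c j : ℝ)| ≤ T}.Finite := by
  refine (Set.Finite.pi' fun _ : Fin m => Set.finite_Icc (-⌊T⌋) ⌊T⌋).subset fun c hc j => ?_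
  have h := abs_le.1 (hc j)
  constructor
  · have : -c j ≤ ⌊T⌋ := Int.le_floor.2 (by push_cast; linarith)
    linarith
  · exact Int.le_floor.2 h.2

theorem stmt_7 (n : ℕ) (hn : 1 ≤ n) (a b : ℝ) (hab : a < b)
    (f : Fin n → ℝ → ℝ) (hf : ∀ i, ContDiffOn ℝ n (f i) (Icc a b))
    (hf1 : ∀ x, f ⟨0, by omega⟩ x = x)
    (hW : ∀ x ∈ Icc a b,
      (Matrix.of fun i j : Fin n =>
        iteratedDerivWithin ((j : ℕ) + 1) (f i) (Icc a b) x).det ≠ 0) :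
    ∃ δ : ℝ, 0 < δ ∧ ∀ x₀ ∈ Icc a b, ∃ I₀ : Set ℝ, I₀ ⊆ Icc a b ∧
      I₀ ∈ nhdsWithin x₀ (Icc a b) ∧
      ∀ u v : ℝ, u < v → Icc u v ⊆ I₀ →
        ∃ Q₁ : ℝ, 0 < Q₁ ∧ ∀ Q : ℝ, Q₁ < Q →
          volume ({x ∈ Icc a b | ∃ c₀ : ℤ, ∃ c : Fin n → ℤ,
              ¬(c₀ = 0 ∧ c = 0) ∧
              ((Finset.univ.sup fun i => (c i).natAbs : ℕ) : ℝ) ≤ Q ∧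
              |(c₀ : ℝ) + ∑ i, (c i : ℝ) * f i x| < δ * Q ^ (-(n : ℤ))} ∩ Icc u v)
            < volume (Icc u v) / 2 := by
  obtain ⟨θ, hθ0, hθ1, hθ⟩ := exists_nondivConst_le (n + 1)
  set K : ℝ := (4 * n + 3) * ((n + 1) / θ) ^ n with hK
  have hK0 : 0 < K := by positivity
  set η : ℝ := 1 / (K + 1) with hη
  have hη0 : 0 < η := by positivity
  have hηK : η * K < 1 := by
    rw [hη, one_div_mul_eq_div, div_lt_one (by positivity)]; linarith
  set N : ℝ := ((n + 1 : ℕ) : ℝ) with hN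
  have hN0 : 0 < N := by rw [hN]; positivity
  set ε' : ℝ := min (1 / 2) (η / N ^ (n + 1)) with hε'
  have hε'0 : 0 < ε' := lt_min (by norm_num) (by positivity)
  have hε'1 : ε' < 1 := (min_le_left _ _).trans_lt (by norm_num)
  have hε'η : N ^ (n + 1) * ε' ≤ η := by
    rw [mul_comm, ← le_div_iff₀ (by positivity)]; exact min_le_right _ _
  set ε : ℝ := ε' / (N ^ (n + 1) * N) with hε
  have hε0 : 0 < ε := by positivity
  have hεε' : N ^ (n + 1) * (N * ε) ≤ ε' := le_of_eq (by rw [hε]; field_simp)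
  refine ⟨ε ^ (n + 1), by positivity, fun x₀ hx₀ => ?_⟩
  obtain ⟨a', b', m, hsub, hnhds, hm, hder⟩ :=
    exists_combDeriv_almost_const hn hab hf hx₀ (hW x₀ hx₀)
  refine ⟨Icc a' b', hsub, hnhds, fun u v huv hJ => ?_⟩
  obtain ⟨κ, hκ0, hκ⟩ := exists_le_abs_combDeriv_of_int hab hf hsub hm hder huv hJ
  refine ⟨max ε (ε / κ), lt_max_of_lt_left hε0, fun Q hQ => ?_⟩
  have hQε : ε < Q := (le_max_left _ _).trans_lt hQ
  have hQκ : ε / κ < Q := (le_max_right _ _).trans_lt hQ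
  have hQ0 : 0 < Q := hε0.trans hQε
  set g : ℝ → Fin (n + 1) → ℝ := fun x => Fin.cons 1 fun i => f i x with hg
  have hsum : ∀ (c : Fin (n + 1) → ℝ) (x : ℝ), ∑ j, c j * g x j = combDeriv f a b c 0 x := by
    intro c x
    rw [combDeriv_zero, Fin.sum_univ_succ]
    simp [hg]
  have hbound : ∀ i, ∃ B, ∀ x ∈ Icc a b, ‖f i x‖ ≤ B := fun i =>
    isCompact_Icc.exists_bound_of_continuousOn (hf i).continuousOn
  choose B hB using hbound
  set T : ℝ := max Q (ε ^ (n + 1) * Q ^ (-(n : ℤ)) + ∑ i, Q * B i) with hT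
  have hmain := volume_exists_short_le (g := g) (u := u) (v := v) (t := Q / ε) (κ := κ) (η := η)
    (θ := ENNReal.ofReal θ) (fun x => rfl) ?_ hη0 ?_ huv.le ?_ ?_ ?_ hε0.le hεε' hε'1 hε'η
    (finite_setOf_abs_intCast_le (n + 1) T)
  · have hvol0 : volume (Icc u v) ≠ 0 := by
      rw [Real.volume_Icc]; simpa using huv
    have hvolt : volume (Icc u v) ≠ ⊤ := by
      rw [Real.volume_Icc]; exact ENNReal.ofReal_ne_top
    have hlt : nondivConst (ENNReal.ofReal θ) (n + 1) * volume (Icc u v) <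
        volume (Icc u v) / 2 := by
      refine (mul_le_mul_left hθ _).trans_lt ?_
      rw [ENNReal.div_eq_inv_mul (a := volume (Icc u v)), one_div]
      refine (ENNReal.mul_lt_mul_iff_left hvol0 hvolt).2 ?_
      rw [ENNReal.inv_lt_inv]
      norm_num
    refine (measure_mono ?_).trans_lt (hmain.trans_lt hlt)
    rintro x ⟨⟨hx, c₀, c, hne, hcQ, hF⟩, hxJ⟩
    have hc : ∀ i, |(c i : ℝ)| ≤ Q := by
      intro i
      refine le_trans ?_ hcQ
      rw [← Int.cast_abs, Int.abs_eq_natAbs, Int.cast_natCast]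
      exact_mod_cast Finset.le_sup (f := fun i => (c i).natAbs) (Finset.mem_univ i)
    refine ⟨hxJ, Fin.cons c₀ c, ?_, ?_, ?_⟩
    · refine Fin.cases ?_ fun i => ?_
      · rw [Fin.cons_zero]
        refine le_trans ?_ (le_max_right _ _)
        have h1 : |∑ i, (c i : ℝ) * f i x| ≤ ∑ i, Q * B i := by
          refine (Finset.abs_sum_le_sum_abs _ _).trans (Finset.sum_le_sum fun i _ => ?_)
          rw [abs_mul]
          exact mul_le_mul (hc i) (hB i x hx) (abs_nonneg _) hQ0.le
        have h2 := abs_sub ((c₀ : ℝ) + ∑ i, (c i : ℝ) * f i x) (∑ i, (c i : ℝ) * f i x)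
        rw [add_sub_cancel_right] at h2
        linarith
      · rw [Fin.cons_succ]
        exact (hc i).trans (le_max_left _ _)
    · intro h
      refine hne ⟨congrFun h 0, funext fun i => ?_⟩
      exact congrFun h i.succ
    · set w : Fin (n + 1) → ℝ := fun j => ((Fin.cons c₀ c : Fin (n + 1) → ℤ) j : ℝ) with hw
      refine Fin.cases ?_ fun i => ?_
      · have h1 : Matrix.vecMul w (flowMatrix ((Q / ε) ^ n) (Q / ε)⁻¹ (g x)) 0 =
            (Q / ε) ^ n * ∑ j, g x j * w j :=
          mul_flowMatrix_zero _ _ _ (Matrix.of fun _ : Fin 1 => w) 0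
        have h2 : ∑ j, g x j * w j = (c₀ : ℝ) + ∑ i, (c i : ℝ) * f i x := by
          simp only [mul_comm (g x _), hsum, combDeriv_zero, hw, Fin.cons_zero, Fin.cons_succ]
        rw [h1, h2, abs_mul, abs_of_pos (by positivity : 0 < (Q / ε) ^ n)]
        calc _ ≤ (Q / ε) ^ n * (ε ^ (n + 1) * Q ^ (-(n : ℤ))) := by gcongr
          _ = ε := by
            rw [zpow_neg, zpow_natCast, div_pow, pow_succ]
            field_simp
      · have h1 : Matrix.vecMul w (flowMatrix ((Q / ε) ^ n) (Q / ε)⁻¹ (g x)) i.succ =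
            (Q / ε)⁻¹ * w i.succ :=
          mul_flowMatrix_of_ne _ _ _ (Matrix.of fun _ : Fin 1 => w) 0 (Fin.succ_ne_zero i)
        rw [h1, abs_mul, abs_of_pos (by positivity : 0 < (Q / ε)⁻¹), inv_div, div_mul_eq_mul_div,
          div_le_iff₀ hQ0]
        exact mul_le_mul_of_nonneg_left (hc i) hε0.le
  · refine Fin.cases continuousOn_const fun i => ?_
    exact (hf i).continuousOn.mono (hJ.trans hsub)
  · intro c s u' v' huv' hJ' y hy hy0 hs
    simp only [hsum] at hy0 hs ⊢
    obtain ⟨k, D, hk1, hkn, -, hD⟩ := hder c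
    rw [Real.volume_Icc, ← ENNReal.ofReal_mul hθ0.le]
    exact ((derivChain_combDeriv hab hf c).mono hkn hsub).volume_sublevel_le hD hk1 hkn hθ0 hθ1 hηK
      huv' (hJ'.trans hJ) hy hy0 hs
  · intro c hc
    obtain ⟨y, hy, h⟩ := hκ c hc
    exact ⟨y, hy, by rwa [hsum]⟩
  · exact (one_le_div hε0).2 hQε.le
  · rw [div_mul_eq_mul_div]
    exact (one_le_div hε0).2 ((div_le_iff₀ hκ0).1 hQκ.le)
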